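/- arXiv:1804.03469 — 2 statements merged into one kernel-verified Lean document; each statement's English description precedes it below -/
import Mathlib

section
/- For all 1 ≤ p, q ≤ ∞, the Banach spaces L_p + L_q on (0, ∞) and L_p ∩ L_q on (0, ∞) are isomorphic if and only if p = q. -/
open MeasureTheory ENNReal

noncomputable section

/-- Lebesgue measure on the half-line `(0, ∞)`. -/
def m0 : MeasureTheory.Measure ℝ := MeasureTheory.volume.restrict (Set.Ioi 0)

/-- The space `L_p + L_q` on `(0, ∞)`, realized as the submodule of (a.e.-equivalence classes
of) measurable functions that are sums of an `L_p` and an `L_q` function. -/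
def sumSpace (p q : ℝ≥0∞) : Submodule ℝ (ℝ →ₘ[m0] ℝ) :=
  Lp.LpSubmodule ℝ ℝ p m0 ⊔ Lp.LpSubmodule ℝ ℝ q m0

/-- The space `L_p ∩ L_q` on `(0, ∞)`, realized as the submodule of (a.e.-equivalence classes
of) measurable functions that belong to both `L_p` and `L_q`. -/
def interSpace (p q : ℝ≥0∞) : Submodule ℝ (ℝ →ₘ[m0] ℝ) :=
  Lp.LpSubmodule ℝ ℝ p m0 ⊓ Lp.LpSubmodule ℝ ℝ q m0

/-- The natural norm on `L_p + L_q`:  `‖f‖ = inf { ‖u‖_p + ‖v‖_q : f = u + v }`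
(with value `∞` outside of the space). -/
def sumNormE (p q : ℝ≥0∞) (f : ℝ →ₘ[m0] ℝ) : ℝ≥0∞ :=
  ⨅ (u : Lp ℝ p m0) (v : Lp ℝ q m0)
    (_ : f = (u : ℝ →ₘ[m0] ℝ) + (v : ℝ →ₘ[m0] ℝ)),
      eLpNorm (u : ℝ → ℝ) p m0 + eLpNorm (v : ℝ → ℝ) q m0

/-- The natural norm on `L_p ∩ L_q`:  `‖f‖ = max (‖f‖_p, ‖f‖_q)`. -/
def interNormE (p q : ℝ≥0∞) (f : ℝ →ₘ[m0] ℝ) : ℝ≥0∞ :=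
  max (eLpNorm (f : ℝ → ℝ) p m0) (eLpNorm (f : ℝ → ℝ) q m0)

/-- `L_p + L_q` and `L_p ∩ L_q` are isomorphic as Banach spaces: there is a linear bijection
between them which, together with its inverse, is bounded. -/
def SumInterIsomorphic (p q : ℝ≥0∞) : Prop :=
  ∃ T : sumSpace p q ≃ₗ[ℝ] interSpace p q, ∃ C : ℝ≥0∞, 0 < C ∧ C < ∞ ∧
    ∀ f : sumSpace p q,
      interNormE p q ((T f : ℝ →ₘ[m0] ℝ)) ≤ C * sumNormE p q (f : ℝ →ₘ[m0] ℝ) ∧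
      sumNormE p q (f : ℝ →ₘ[m0] ℝ) ≤ C * interNormE p q ((T f : ℝ →ₘ[m0] ℝ))


/-! ### Signs -/

noncomputable def sgn (b : Bool) : ℝ := if b then 1 else -1

lemma sgn_mul_self (b : Bool) : sgn b * sgn b = 1 := by cases b <;> simp [sgn]
lemma sgn_abs (b : Bool) : |sgn b| = 1 := by cases b <;> simp [sgn]
lemma sgn_not (b : Bool) : sgn (!b) = - sgn b := by cases b <;> simp [sgn]

section signs
variable {ι : Type} [Fintype ι] [DecidableEq ι]

lemma sum_sgn_mul (j k : ι) :
    ∑ ε : ι → Bool, sgn (ε j) * sgn (ε k) = if j = k then (2:ℝ) ^ Fintype.card ι else 0 := by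
  split_ifs with h
  · subst h
    simp [sgn_mul_self]
  · let e : (ι → Bool) ≃ (ι → Bool) := 
      (Function.Involutive.toPerm (fun ε => Function.update ε j (!(ε j))) (by
        intro ε; simp))
    have h1 := Equiv.sum_comp e (fun ε : ι → Bool => sgn (ε j) * sgn (ε k))
    have h2 : ∀ ε, sgn (e ε j) * sgn (e ε k) = - (sgn (ε j) * sgn (ε k)) := by
      intro ε
      have : k ≠ j := fun h' => h h'.symm
      have he : e ε = Function.update ε j (!(ε j)) := rfl
      rw [he]
      simp [this, sgn_not]
    simp only [h2, Finset.sum_neg_distrib] at h1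
    linarith

/-- `∑ ε_i S_ε = 2^n a_i`. -/
lemma sum_sgn_mul_sum (a : ι → ℝ) (i : ι) :
    ∑ ε : ι → Bool, sgn (ε i) * ∑ k, sgn (ε k) * a k = 2 ^ Fintype.card ι * a i := by
  simp_rw [Finset.mul_sum]
  rw [Finset.sum_comm]
  simp_rw [← mul_assoc, ← Finset.sum_mul, sum_sgn_mul]
  simp

lemma sum_sq_sgn (a : ι → ℝ) :
    ∑ ε : ι → Bool, (∑ k, sgn (ε k) * a k) ^ 2 = 2 ^ Fintype.card ι * ∑ k, a k ^ 2 := by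
  have : ∀ ε : ι → Bool, (∑ k, sgn (ε k) * a k) ^ 2 =
      ∑ i, a i * (sgn (ε i) * ∑ k, sgn (ε k) * a k) := by
    intro ε
    rw [sq, Finset.sum_mul]
    exact Finset.sum_congr rfl fun i _ => by ring
  simp_rw [this]
  rw [Finset.sum_comm]
  simp_rw [← Finset.mul_sum, sum_sgn_mul_sum]
  rw [Finset.mul_sum]
  exact Finset.sum_congr rfl fun i _ => by ring

lemma sum_exp_sgn (a : ι → ℝ) :
    ∑ ε : ι → Bool, Real.exp (∑ k, sgn (ε k) * a k) ≤
      2 ^ Fintype.card ι * Real.exp ((∑ k, a k ^ 2) / 2) := by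
  have h1 : ∑ ε : ι → Bool, Real.exp (∑ k, sgn (ε k) * a k) = ∏ k : ι, (2 * Real.cosh (a k)) := by
    have := Finset.prod_univ_sum (fun _ : ι => (Finset.univ : Finset Bool))
      (fun k b => Real.exp (sgn b * a k))
    rw [Fintype.piFinset_univ] at this
    simp_rw [Real.exp_sum]
    rw [← this]
    refine Finset.prod_congr rfl fun k _ => ?_
    simp [sgn, Real.cosh_eq]
    ring
  rw [h1, Finset.prod_mul_distrib, Finset.sum_div, Real.exp_sum]
  simp only [Finset.prod_const, Finset.card_univ]
  gcongr with i
  exact Real.cosh_le_exp_half_sq _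

lemma abs_rpow_le_exp (q : ℝ) (hq : 0 < q) : ∃ C : ℝ, 0 < C ∧ ∀ x : ℝ,
    |x| ^ q ≤ C * (Real.exp x + Real.exp (-x)) := by
  obtain ⟨n, hn⟩ := exists_nat_ge q
  refine ⟨1 + n.factorial, by positivity, fun x => ?_⟩
  have h1 : |x| ^ q ≤ 1 + |x| ^ n := by
    rcases le_total |x| 1 with h | h
    · have := Real.rpow_le_one (abs_nonneg x) h hq.le
      have : 0 ≤ |x| ^ n := by positivity
      linarith
    · have := Real.rpow_le_rpow_of_exponent_le h hn
      rw [Real.rpow_natCast] at this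
      linarith
  have h2 : |x| ^ n ≤ n.factorial * Real.exp |x| := by
    have := Real.pow_div_factorial_le_exp |x| (abs_nonneg x) n
    rw [div_le_iff₀ (by positivity)] at this
    linarith
  have h3 : (1:ℝ) ≤ Real.exp |x| := Real.one_le_exp (abs_nonneg x)
  have h4 : Real.exp |x| ≤ Real.exp x + Real.exp (-x) := by
    rcases abs_cases x with ⟨h, _⟩ | ⟨h, _⟩ <;> rw [h] <;> linarith [Real.exp_pos x, Real.exp_pos (-x)]
  calc |x| ^ q ≤ (1 + n.factorial) * Real.exp |x| := by linarith
    _ ≤ _ := by gcongr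

/-- Khinchine, upper estimate. -/
lemma khinchine_upper (q : ℝ) (hq : 0 < q) : ∃ C : ℝ, 0 < C ∧ ∀ (ι : Type) [Fintype ι]
    [DecidableEq ι] (a : ι → ℝ),
    ∑ ε : ι → Bool, |∑ k, sgn (ε k) * a k| ^ q ≤
      C * 2 ^ Fintype.card ι * (∑ k, a k ^ 2) ^ (q / 2) := by
  obtain ⟨C, hC, h⟩ := abs_rpow_le_exp q hq
  refine ⟨C * (2 * Real.exp (1 / 2)), by positivity, fun ι _ _ a => ?_⟩
  rcases eq_or_ne (∑ k, a k ^ 2) 0 with h0 | h0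
  · have : ∀ k, a k = 0 := by
      intro k
      have := (Finset.sum_eq_zero_iff_of_nonneg (fun i _ => sq_nonneg (a i))).1 h0 k (Finset.mem_univ k)
      simpa using this
    simp [this, hq.ne', Real.zero_rpow (show q / 2 ≠ 0 by positivity)]
  have hs : 0 < ∑ k, a k ^ 2 := lt_of_le_of_ne (Finset.sum_nonneg fun i _ => sq_nonneg (a i)) h0.symm
  set s := ∑ k, a k ^ 2 with hs'
  set t := Real.sqrt s
  have ht : 0 < t := Real.sqrt_pos.2 hs
  have ht2 : t ^ 2 = s := Real.sq_sqrt hs.le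
  have hsum : ∑ k, (a k / t) ^ 2 = 1 := by
    simp_rw [div_pow, ← Finset.sum_div]
    rw [ht2]; field_simp
    exact hs'.symm
  have e1 := sum_exp_sgn (fun k => a k / t)
  have e2 := sum_exp_sgn (fun k => -(a k / t))
  simp only [neg_sq, hsum] at e1 e2
  have key : ∀ ε : ι → Bool, |∑ k, sgn (ε k) * a k| ^ q ≤ s ^ (q / 2) * (C *
      (Real.exp (∑ k, sgn (ε k) * (a k / t)) + Real.exp (∑ k, sgn (ε k) * -(a k / t)))) := by
    intro ε
    have e3 : ∑ k, sgn (ε k) * a k = t * ∑ k, sgn (ε k) * (a k / t) := by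
      rw [Finset.mul_sum]
      exact Finset.sum_congr rfl fun k _ => by field_simp
    have e4 : ∑ k, sgn (ε k) * -(a k / t) = - ∑ k, sgn (ε k) * (a k / t) := by
      simp
    rw [e3, e4, abs_mul, abs_of_pos ht, Real.mul_rpow ht.le (abs_nonneg _)]
    have e5 : t ^ q = s ^ (q / 2) := by
      rw [← ht2, ← Real.rpow_natCast, ← Real.rpow_mul ht.le]
      congr 1; push_cast; ring
    rw [e5]
    gcongr
    exact h _
  calc _ ≤ ∑ ε : ι → Bool, s ^ (q / 2) * (C *
      (Real.exp (∑ k, sgn (ε k) * (a k / t)) + Real.exp (∑ k, sgn (ε k) * -(a k / t)))) :=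
        Finset.sum_le_sum fun ε _ => key ε
    _ = s ^ (q / 2) * (C * (∑ ε : ι → Bool, Real.exp (∑ k, sgn (ε k) * (a k / t)) +
        ∑ ε : ι → Bool, Real.exp (∑ k, sgn (ε k) * -(a k / t)))) := by
        rw [← Finset.mul_sum, ← Finset.mul_sum, Finset.sum_add_distrib]
    _ ≤ s ^ (q / 2) * (C * (2 ^ Fintype.card ι * Real.exp (1 / 2) +
          2 ^ Fintype.card ι * Real.exp (1 / 2))) := by gcongr
    _ = _ := by ring

/-- Khinchine, lower estimate in `L_1`. -/
lemma khinchine_lower : ∃ c : ℝ, 0 < c ∧ ∀ (ι : Type) [Fintype ι]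
    [DecidableEq ι] (a : ι → ℝ),
    c * 2 ^ Fintype.card ι * Real.sqrt (∑ k, a k ^ 2) ≤ ∑ ε : ι → Bool, |∑ k, sgn (ε k) * a k| := by
  obtain ⟨C, hC, h⟩ := khinchine_upper 4 (by norm_num)
  -- choose `l` with `l - l^3 C > 0`
  obtain ⟨l, hl0, hl⟩ : ∃ l : ℝ, 0 < l ∧ l ^ 2 * C ≤ 1 / 2 := by
    refine ⟨min 1 (1 / (2 * C)), by positivity, ?_⟩
    have h1 : min 1 (1 / (2 * C)) ≤ 1 := min_le_left _ _
    have h2 : min 1 (1 / (2 * C)) ≤ 1 / (2 * C) := min_le_right _ _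
    have h0 : 0 < min 1 (1 / (2 * C)) := by positivity
    have h3 : min 1 (1 / (2 * C)) ^ 2 ≤ 1 / (2 * C) := by nlinarith
    calc _ ≤ 1 / (2 * C) * C := by gcongr
      _ = 1 / 2 := by field_simp
  refine ⟨l / 2, by positivity, fun ι _ _ a => ?_⟩
  set s := ∑ k, a k ^ 2 with hs'
  have hs0 : 0 ≤ s := Finset.sum_nonneg fun i _ => sq_nonneg (a i)
  set t := Real.sqrt s
  have ht2 : t ^ 2 = s := Real.sq_sqrt hs0
  rcases (Real.sqrt_nonneg s).eq_or_lt with ht | ht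
  · change 0 = t at ht
    rw [← ht, mul_zero]
    exact Finset.sum_nonneg fun _ _ => abs_nonneg _
  change 0 < t at ht
  have h4 := h ι a
  have h2 := sum_sq_sgn a
  rw [← hs'] at h2 h4
  have hs4 : s ^ ((4:ℝ) / 2) = t ^ 4 := by
    rw [← ht2, show (4:ℝ)/2 = ((2:ℕ):ℝ) by norm_num, Real.rpow_natCast]; ring
  rw [hs4] at h4
  have key : ∀ x : ℝ, (l / t) * x ^ 2 - (l / t) ^ 3 * |x| ^ (4:ℝ) ≤ |x| := by
    intro x
    have : |x| ^ (4:ℝ) = |x| ^ 4 := by exact_mod_cast Real.rpow_natCast |x| 4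
    rw [this, ← sq_abs]
    set m := l / t
    have hm : 0 < m := by positivity
    have hx := abs_nonneg x
    set y := |x|
    have : m * (m * y ^ 2 - m ^ 3 * y ^ 4) ≤ m * y := by
      have hz : 0 ≤ m * y := by positivity
      have : m * (m * y ^ 2 - m ^ 3 * y ^ 4) = (m * y) ^ 2 - (m * y) ^ 4 := by ring
      rw [this]
      rcases le_total (m * y) 1 with h | h
      · nlinarith [pow_nonneg hz 4]
      · have : (m*y)^2 ≤ (m*y)^4 := pow_le_pow_right₀ h (by norm_num)
        linarith
    exact le_of_mul_le_mul_left this hm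
  have := Finset.sum_le_sum fun (ε : ι → Bool) (_ : ε ∈ Finset.univ) => key (∑ k, sgn (ε k) * a k)
  rw [Finset.sum_sub_distrib, ← Finset.mul_sum, ← Finset.mul_sum, h2] at this
  refine le_trans ?_ this
  have h5 : (l / t) ^ 3 * ∑ ε : ι → Bool, |∑ k, sgn (ε k) * a k| ^ (4:ℝ) ≤
      (l / t) ^ 3 * (C * 2 ^ Fintype.card ι * t ^ 4) := by gcongr
  have h6 : (l / t) ^ 3 * (C * 2 ^ Fintype.card ι * t ^ 4) = l * (l ^ 2 * C) * 2 ^ Fintype.card ι * t := by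
    field_simp
  have h7 : l * (l ^ 2 * C) * 2 ^ Fintype.card ι * t ≤ l * (1 / 2) * 2 ^ Fintype.card ι * t := by
    gcongr
  have h8 : l / t * (2 ^ Fintype.card ι * s) = l * 2 ^ Fintype.card ι * t := by
    rw [← ht2]; field_simp
  rw [h8]
  linarith

/-- any coefficient is dominated by the average. -/
lemma coeff_le_avg (p : ℝ) (hp : 1 ≤ p) (a : ι → ℝ) (i : ι) :
    2 ^ Fintype.card ι * |a i| ^ p ≤ ∑ ε : ι → Bool, |∑ k, sgn (ε k) * a k| ^ p := by
  have h1 := sum_sgn_mul_sum a i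
  have h2 : 2 ^ Fintype.card ι * |a i| ≤ ∑ ε : ι → Bool, |∑ k, sgn (ε k) * a k| := by
    calc 2 ^ Fintype.card ι * |a i| = |2 ^ Fintype.card ι * a i| := by
          rw [abs_mul, abs_of_pos (show (0:ℝ) < 2 ^ Fintype.card ι by positivity)]
      _ ≤ ∑ ε : ι → Bool, |sgn (ε i) * ∑ k, sgn (ε k) * a k| := by
          rw [← h1]; exact Finset.abs_sum_le_sum_abs _ _
      _ = _ := by simp [abs_mul, sgn_abs]
  have h4 := Real.rpow_sum_le_const_mul_sum_rpow (s := (Finset.univ : Finset (ι → Bool)))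
    (fun ε => ∑ k, sgn (ε k) * a k) hp
  have hc : ((Finset.univ : Finset (ι → Bool)).card : ℝ) = 2 ^ Fintype.card ι := by simp
  rw [hc] at h4
  set M : ℝ := 2 ^ Fintype.card ι
  have hM : 0 < M := by positivity
  have h5 : (M * |a i|) ^ p ≤ M ^ (p - 1) * ∑ ε : ι → Bool, |∑ k, sgn (ε k) * a k| ^ p :=
    (Real.rpow_le_rpow (by positivity) h2 (by linarith)).trans h4
  rw [Real.mul_rpow hM.le (abs_nonneg _)] at h5
  have h6 : M ^ p = M ^ (p - 1) * M := by
    rw [← Real.rpow_add_one hM.ne']; simp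
  rw [h6, mul_assoc] at h5
  exact le_of_mul_le_mul_left h5 (by positivity)

end signs

/-! ### Setup -/

abbrev A0 := ℝ →ₘ[m0] ℝ

/-- `L_r` norm. -/
def NN (r : ℝ≥0∞) (f : A0) : ℝ≥0∞ := eLpNorm (f : ℝ → ℝ) r m0

lemma NN_zero (r : ℝ≥0∞) : NN r 0 = 0 := by
  unfold NN
  rw [eLpNorm_congr_ae AEEqFun.coeFn_zero]; simp

lemma NN_add_le {r : ℝ≥0∞} (hr : 1 ≤ r) (f g : A0) : NN r (f + g) ≤ NN r f + NN r g := by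
  unfold NN
  rw [eLpNorm_congr_ae (AEEqFun.coeFn_add f g)]
  exact eLpNorm_add_le f.aestronglyMeasurable g.aestronglyMeasurable hr

lemma NN_smul (r : ℝ≥0∞) (c : ℝ) (f : A0) : NN r (c • f) = ‖c‖ₑ * NN r f := by
  unfold NN
  rw [eLpNorm_congr_ae (AEEqFun.coeFn_smul c f), eLpNorm_const_smul]

lemma coeFn_lin {ι : Type} (s : Finset ι) (c : ι → ℝ) (f : ι → A0) :
    ⇑(∑ i ∈ s, c i • f i) =ᵐ[m0] fun x => ∑ i ∈ s, c i * f i x := by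
  have h1 := AEEqFun.coeFn_fun_finsetSum (μ := m0) s (fun i => c i • f i)
  have h2 : ∀ᵐ x ∂m0, ∀ i ∈ s, (c i • f i : A0) x = c i * f i x := by
    rw [Filter.eventually_all_finset]
    intro i _
    filter_upwards [AEEqFun.coeFn_smul (c i) (f i)] with x hx
    simpa using hx
  filter_upwards [h1, h2] with x h1 h2
  rw [h1]
  exact Finset.sum_congr rfl h2

lemma NN_sum_le {ι : Type} {r : ℝ≥0∞} (hr : 1 ≤ r) (s : Finset ι) (f : ι → A0) :
    NN r (∑ i ∈ s, f i) ≤ ∑ i ∈ s, NN r (f i) := by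
  classical
  induction s using Finset.induction_on with
  | empty => simp [NN_zero]
  | insert a s ha ih =>
    rw [Finset.sum_insert ha, Finset.sum_insert ha]
    exact (NN_add_le hr _ _).trans (by gcongr)

lemma NN_mono (r : ℝ≥0∞) {f g : A0} (h : ∀ᵐ x ∂m0, |f x| ≤ |g x|) : NN r f ≤ NN r g :=
  eLpNorm_mono_ae (by simpa using h)

/-- cutting a function to a set -/
def cut (E : Set ℝ) (hE : MeasurableSet E) (f : A0) : A0 :=
  AEEqFun.mk (E.indicator f) (f.aestronglyMeasurable.indicator hE)

lemma cut_coe (E : Set ℝ) (hE : MeasurableSet E) (f : A0) : ⇑(cut E hE f) =ᵐ[m0] E.indicator f :=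
  AEEqFun.coeFn_mk _ _

lemma NN_cut (r : ℝ≥0∞) (E : Set ℝ) (hE : MeasurableSet E) (f : A0) :
    NN r (cut E hE f) = eLpNorm (f : ℝ → ℝ) r (m0.restrict E) := by
  unfold NN
  rw [eLpNorm_congr_ae (cut_coe E hE f), eLpNorm_indicator_eq_eLpNorm_restrict hE]

lemma NN_cut_le (r : ℝ≥0∞) (E : Set ℝ) (hE : MeasurableSet E) (f : A0) :
    NN r (cut E hE f) ≤ NN r f := by
  rw [NN_cut]
  exact eLpNorm_mono_measure _ Measure.restrict_le_self

lemma cut_add_compl (E : Set ℝ) (hE : MeasurableSet E) (f : A0) :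
    f = cut E hE f + cut Eᶜ hE.compl f := by
  apply AEEqFun.ext
  filter_upwards [AEEqFun.coeFn_add (cut E hE f) (cut Eᶜ hE.compl f), cut_coe E hE f,
    cut_coe Eᶜ hE.compl f] with x h1 h2 h3
  rw [h1, Pi.add_apply, h2, h3]
  exact (congrFun (Set.indicator_self_add_compl E (f : ℝ → ℝ)) x).symm

/-- indicator -/
def chi (E : Set ℝ) (hE : MeasurableSet E) : A0 :=
  AEEqFun.mk (E.indicator fun _ => (1:ℝ)) (aestronglyMeasurable_const.indicator hE)

lemma chi_coe (E : Set ℝ) (hE : MeasurableSet E) :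
    ⇑(chi E hE) =ᵐ[m0] E.indicator fun _ => (1:ℝ) :=
  AEEqFun.coeFn_mk _ _

lemma m0_Ioc (a b : ℝ) (ha : 0 ≤ a) : m0 (Set.Ioc a b) = ENNReal.ofReal (b - a) := by
  unfold m0
  rw [Measure.restrict_apply measurableSet_Ioc, Set.inter_eq_left.2, Real.volume_Ioc]
  intro x hx
  exact lt_of_le_of_lt ha hx.1

lemma NN_chi {r : ℝ≥0∞} (hr : r ≠ 0) (a b : ℝ) (ha : 0 ≤ a) (hab : a < b) :
    NN r (chi (Set.Ioc a b) measurableSet_Ioc) = ENNReal.ofReal ((b - a) ^ (1 / r.toReal)) := by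
  unfold NN
  rw [eLpNorm_congr_ae (chi_coe _ _), eLpNorm_indicator_const' measurableSet_Ioc _ hr, m0_Ioc a b ha,
    ENNReal.ofReal_rpow_of_pos (by linarith)]
  · simp
  · rw [m0_Ioc a b ha]
    simpa using hab

abbrev II (i : ℕ) : Set ℝ := Set.Ioc (i:ℝ) (i + 1)

instance (i : ℕ) : IsProbabilityMeasure (m0.restrict (II i)) := ⟨by
  rw [Measure.restrict_apply_univ, m0_Ioc _ _ (by positivity)]; simp⟩

/-- `L_1` norm on the `i`-th interval -/
def JJ (i : ℕ) (f : A0) : ℝ≥0∞ := eLpNorm (f : ℝ → ℝ) 1 (m0.restrict (II i))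

lemma JJ_le {r : ℝ≥0∞} (hr : 1 ≤ r) (i : ℕ) (f : A0) : JJ i f ≤ NN r f :=
  (eLpNorm_le_eLpNorm_of_exponent_le hr f.aestronglyMeasurable.restrict).trans
    (eLpNorm_mono_measure _ Measure.restrict_le_self)

lemma JJ_add_le (i : ℕ) (f g : A0) : JJ i (f + g) ≤ JJ i f + JJ i g := by
  unfold JJ
  rw [eLpNorm_congr_ae (ae_restrict_of_ae (AEEqFun.coeFn_add f g))]
  exact eLpNorm_add_le f.aestronglyMeasurable.restrict g.aestronglyMeasurable.restrict le_rfl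

structure Dat (p q : ℝ≥0∞) (C : ℝ) (τ σ : A0 →ₗ[ℝ] A0) : Prop where
  one_le : 1 ≤ C
  tpp : ∀ f, NN p (τ f) ≤ ENNReal.ofReal C * NN p f
  tpq : ∀ f, NN p (τ f) ≤ ENNReal.ofReal C * NN q f
  tqp : ∀ f, NN q (τ f) ≤ ENNReal.ofReal C * NN p f
  tqq : ∀ f, NN q (τ f) ≤ ENNReal.ofReal C * NN q f
  s : ∀ g, NN p g < ∞ → NN q g < ∞ → ∃ u v, σ g = u + v ∧
    NN p u + NN q v ≤ ENNReal.ofReal C * max (NN p g) (NN q g)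
  τσ : ∀ g, NN p g < ∞ → NN q g < ∞ → τ (σ g) = g
  στ : ∀ g, NN p g < ∞ → NN q g < ∞ → σ (τ g) = g

lemma Dat.symm {p q : ℝ≥0∞} {C : ℝ} {τ σ : A0 →ₗ[ℝ] A0} (D : Dat p q C τ σ) : Dat q p C τ σ where
  one_le := D.one_le
  tpp := D.tqq
  tpq := D.tqp
  tqp := D.tpq
  tqq := D.tpp
  s g h1 h2 := by
    obtain ⟨u, v, h, h'⟩ := D.s g h2 h1
    exact ⟨v, u, by rw [h, add_comm], by rw [add_comm, max_comm]; exact h'⟩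
  τσ g h1 h2 := D.τσ g h2 h1
  στ g h1 h2 := D.στ g h2 h1

lemma Dat.JJσ {p q : ℝ≥0∞} {C : ℝ} {τ σ : A0 →ₗ[ℝ] A0} (D : Dat p q C τ σ) (hp : 1 ≤ p) (hq : 1 ≤ q)
    (i : ℕ) (g : A0) (M : ℝ≥0∞) (hM : M ≠ ∞) (h1 : NN p g ≤ M) (h2 : NN q g ≤ M) :
    JJ i (σ g) ≤ ENNReal.ofReal C * M := by
  obtain ⟨u, v, h, h'⟩ := D.s g (h1.trans_lt hM.lt_top) (h2.trans_lt hM.lt_top)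
  rw [h]
  refine (JJ_add_le i u v).trans ?_
  calc _ ≤ NN p u + NN q v := add_le_add (JJ_le hp i u) (JJ_le hq i v)
    _ ≤ _ := h'
    _ ≤ _ := by gcongr; exact max_le h1 h2

lemma mem_Lpsub (r : ℝ≥0∞) (f : A0) : f ∈ Lp.LpSubmodule ℝ ℝ r m0 ↔ NN r f < ∞ :=
  Lp.mem_Lp_iff_eLpNorm_lt_top

lemma mem_inter (p q : ℝ≥0∞) (f : A0) : f ∈ interSpace p q ↔ NN p f < ∞ ∧ NN q f < ∞ := by
  unfold interSpace
  rw [Submodule.mem_inf, mem_Lpsub, mem_Lpsub]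

lemma mem_sum_left (p q : ℝ≥0∞) (f : A0) (h : NN p f < ∞) : f ∈ sumSpace p q :=
  Submodule.mem_sup_left ((mem_Lpsub _ _).2 h)

lemma mem_sum_right (p q : ℝ≥0∞) (f : A0) (h : NN q f < ∞) : f ∈ sumSpace p q :=
  Submodule.mem_sup_right ((mem_Lpsub _ _).2 h)

lemma sumNormE_le (p q : ℝ≥0∞) (u v : A0) (hu : NN p u < ∞) (hv : NN q v < ∞) :
    sumNormE p q (u + v) ≤ NN p u + NN q v := by
  unfold sumNormE
  exact iInf_le_of_le (⟨u, (mem_Lpsub p u).2 hu⟩ : Lp ℝ p m0)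
    (iInf_le_of_le (⟨v, (mem_Lpsub q v).2 hv⟩ : Lp ℝ q m0) (iInf_le_of_le rfl le_rfl))

lemma exists_of_sumNormE_lt (p q : ℝ≥0∞) (f : A0) (M : ℝ≥0∞) (h : sumNormE p q f < M) :
    ∃ u v : A0, f = u + v ∧ NN p u + NN q v < M := by
  unfold sumNormE at h
  simp only [iInf_lt_iff] at h
  obtain ⟨u, v, h, h'⟩ := h
  exact ⟨u, v, h, h'⟩

lemma NN_eq_zero {r : ℝ≥0∞} (hr : r ≠ 0) (f : A0) (h : NN r f = 0) : f = 0 := by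
  unfold NN at h
  rw [eLpNorm_eq_zero_iff f.aestronglyMeasurable hr] at h
  exact AEEqFun.ext (h.trans AEEqFun.coeFn_zero.symm)

lemma exists_Dat (p q : ℝ≥0∞) (hp : 1 ≤ p) (h : SumInterIsomorphic p q) :
    ∃ C τ σ, Dat p q C τ σ := by
  obtain ⟨T, C, hC0, hC, hT⟩ := h
  obtain ⟨τ, hτ⟩ := LinearMap.exists_extend ((interSpace p q).subtype ∘ₗ T.toLinearMap)
  obtain ⟨σ, hσ⟩ := LinearMap.exists_extend ((sumSpace p q).subtype ∘ₗ T.symm.toLinearMap)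
  have hτ' : ∀ f (hf : f ∈ sumSpace p q), τ f = T ⟨f, hf⟩ := fun f hf =>
    LinearMap.congr_fun hτ ⟨f, hf⟩
  have hσ' : ∀ f (hf : f ∈ interSpace p q), σ f = T.symm ⟨f, hf⟩ := fun f hf =>
    LinearMap.congr_fun hσ ⟨f, hf⟩
  have hle : ∀ f (hf : f ∈ sumSpace p q) (M : ℝ≥0∞), sumNormE p q f ≤ M →
      max (NN p (τ f)) (NN q (τ f)) ≤ ENNReal.ofReal (2 * C.toReal + 1) * M := by
    intro f hf M hM
    have := (hT ⟨f, hf⟩).1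
    rw [← hτ'] at this
    refine this.trans ?_
    gcongr
    rw [← ENNReal.ofReal_toReal hC.ne]
    apply ENNReal.ofReal_le_ofReal
    rw [ENNReal.toReal_ofReal (by positivity)]
    linarith [ENNReal.toReal_nonneg (a := C)]
  have hpos : ENNReal.ofReal (2 * C.toReal + 1) ≠ 0 := by
    have := ENNReal.toReal_nonneg (a := C)
    simp; linarith
  have hl : ∀ f, max (NN p (τ f)) (NN q (τ f)) ≤ ENNReal.ofReal (2 * C.toReal + 1) * NN p f := by
    intro f
    rcases eq_or_ne (NN p f) ∞ with h | h
    · rw [h, ENNReal.mul_top hpos]; exact le_top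
    · apply hle f (mem_sum_left _ _ _ h.lt_top)
      have := sumNormE_le p q f 0 h.lt_top (by simp [NN_zero])
      simpa [NN_zero] using this
  have hr : ∀ f, max (NN p (τ f)) (NN q (τ f)) ≤ ENNReal.ofReal (2 * C.toReal + 1) * NN q f := by
    intro f
    rcases eq_or_ne (NN q f) ∞ with h | h
    · rw [h, ENNReal.mul_top hpos]; exact le_top
    · apply hle f (mem_sum_right _ _ _ h.lt_top)
      have := sumNormE_le p q 0 f (by simp [NN_zero]) h.lt_top
      simpa [NN_zero] using this
  refine ⟨2 * C.toReal + 1, τ, σ, ⟨by linarith [ENNReal.toReal_nonneg (a := C)],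
    fun f => (le_max_left _ _).trans (hl f), fun f => (le_max_left _ _).trans (hr f),
    fun f => (le_max_right _ _).trans (hl f), fun f => (le_max_right _ _).trans (hr f),
    fun g h1 h2 => ?_, fun g h1 h2 => ?_, fun g h1 h2 => ?_⟩⟩
  · have hg := (mem_inter p q g).2 ⟨h1, h2⟩
    rcases eq_or_ne (max (NN p g) (NN q g)) 0 with h0 | h0
    · have : g = 0 := NN_eq_zero (zero_lt_one.trans_le hp).ne' g
        (le_antisymm ((le_max_left _ _).trans h0.le) bot_le)
      refine ⟨0, 0, by simp [this], by simp [NN_zero]⟩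
    · have h3 := (hT (T.symm ⟨g, hg⟩)).2
      rw [← hσ' g hg, T.apply_symm_apply] at h3
      have h4 : sumNormE p q (σ g) < ENNReal.ofReal (2 * C.toReal + 1) * max (NN p g) (NN q g) := by
        refine lt_of_le_of_lt h3 ?_
        change C * max (NN p g) (NN q g) < _
        refine (ENNReal.mul_lt_mul_iff_left h0 (max_lt h1 h2).ne).2 ?_
        nth_rw 1 [← ENNReal.ofReal_toReal hC.ne]
        have := ENNReal.toReal_nonneg (a := C)
        exact (ENNReal.ofReal_lt_ofReal_iff (by linarith)).2 (by linarith)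
      obtain ⟨u, v, h5, h6⟩ := exists_of_sumNormE_lt _ _ _ _ h4
      exact ⟨u, v, h5, h6.le⟩
  · have hg := (mem_inter p q g).2 ⟨h1, h2⟩
    rw [hσ' g hg, hτ' _ (Subtype.coe_prop _)]
    simp
  · have hg := mem_sum_left p q g h1
    rw [hτ' g hg, hσ' _ (Subtype.coe_prop _)]
    simp

/-! ### The trivial direction -/
lemma iso_self (p : ℝ≥0∞) (hp : 1 ≤ p) : SumInterIsomorphic p p := by
  have he : sumSpace p p = interSpace p p := by simp [sumSpace, interSpace]
  refine ⟨LinearEquiv.ofEq _ _ he, 1, one_pos, one_lt_top, fun f => ?_⟩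
  have hf : NN p (f : A0) < ∞ := by
    exact ((mem_inter _ _ _).1 (he.le f.2)).1
  have h1 : interNormE p p ((LinearEquiv.ofEq _ _ he f : interSpace p p) : A0) = NN p (f : A0) := by
    simp [interNormE, NN]
  rw [h1, one_mul, one_mul]
  constructor
  · unfold sumNormE
    refine le_iInf fun u => le_iInf fun v => le_iInf fun h => ?_
    rw [h]
    exact NN_add_le hp _ _
  · have := sumNormE_le p p f 0 hf (by simp [NN_zero])
    simpa [NN_zero] using this

/-! ### Auxiliary lemmas -/

lemma no_growth {a b s t : ℝ} (ha : 0 < a) (hst : s < t)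
    (h : ∀ m : ℕ, 1 ≤ m → a * (m:ℝ) ^ t ≤ b * (m:ℝ) ^ s) : False := by
  have h1 : Filter.Tendsto (fun m : ℕ => ((m:ℝ)) ^ (t - s)) Filter.atTop Filter.atTop :=
    (tendsto_rpow_atTop (by linarith)).comp tendsto_natCast_atTop_atTop
  obtain ⟨m, hm1, hm2⟩ := ((h1.eventually_gt_atTop (b / a)).and (Filter.eventually_ge_atTop 1)).exists
  have hm0 : (0:ℝ) < m := by exact_mod_cast hm2
  have h2 := h m hm2
  rw [Real.rpow_sub hm0, div_lt_div_iff₀ ha (by positivity)] at hm1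
  linarith

lemma inv_toReal_lt {p q : ℝ≥0∞} (hp : 1 ≤ p) (hpq : p < q) : 1 / q.toReal < 1 / p.toReal := by
  have hp' : p ≠ ∞ := (hpq.trans_le le_top).ne
  have h1 : 0 < p.toReal := ENNReal.toReal_pos (zero_lt_one.trans_le hp).ne' hp'
  rcases eq_or_ne q ∞ with h | h
  · simp [h, h1]
  · exact one_div_lt_one_div_of_lt h1 ((ENNReal.toReal_lt_toReal hp' h).2 hpq)

lemma NN_rpow {p : ℝ≥0∞} (h0 : p ≠ 0) (ht : p ≠ ∞) (f : A0) :
    NN p f ^ p.toReal = ∫⁻ x, ENNReal.ofReal (|f x| ^ p.toReal) ∂m0 := by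
  unfold NN
  have hp : 0 < p.toReal := ENNReal.toReal_pos h0 ht
  rw [eLpNorm_eq_lintegral_rpow_enorm_toReal h0 ht, ← ENNReal.rpow_mul, one_div,
    inv_mul_cancel₀ hp.ne', ENNReal.rpow_one]
  refine lintegral_congr fun x => ?_
  rw [← ENNReal.ofReal_rpow_of_nonneg (abs_nonneg _) hp.le, Real.enorm_eq_ofReal_abs]

lemma NN_cut_rpow {p : ℝ≥0∞} (h0 : p ≠ 0) (ht : p ≠ ∞) (E : Set ℝ) (hE : MeasurableSet E) (f : A0) :
    NN p (cut E hE f) ^ p.toReal = ∫⁻ x in E, ENNReal.ofReal (|f x| ^ p.toReal) ∂m0 := by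
  have hp : 0 < p.toReal := ENNReal.toReal_pos h0 ht
  rw [NN_cut, eLpNorm_eq_lintegral_rpow_enorm_toReal h0 ht, ← ENNReal.rpow_mul, one_div,
    inv_mul_cancel₀ hp.ne', ENNReal.rpow_one]
  refine lintegral_congr fun x => ?_
  rw [← ENNReal.ofReal_rpow_of_nonneg (abs_nonneg _) hp.le, Real.enorm_eq_ofReal_abs]

lemma NN_rpow_lin {p : ℝ≥0∞} (h0 : p ≠ 0) (ht : p ≠ ∞) {ι : Type} [Fintype ι] (c : ι → ℝ)
    (h : ι → A0) :
    NN p (∑ k, c k • h k) ^ p.toReal =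
      ∫⁻ x, ENNReal.ofReal (|∑ k, c k * h k x| ^ p.toReal) ∂m0 := by
  rw [NN_rpow h0 ht]
  refine lintegral_congr_ae ?_
  filter_upwards [coeFn_lin Finset.univ c h] with x hx
  rw [hx]

lemma sum_NN_rpow {p : ℝ≥0∞} (h0 : p ≠ 0) (ht : p ≠ ∞) {ι : Type} [Fintype ι] [DecidableEq ι]
    (h : ι → A0) :
    ∑ ε : ι → Bool, NN p (∑ k, sgn (ε k) • h k) ^ p.toReal =
      ∫⁻ x, ENNReal.ofReal (∑ ε : ι → Bool, |∑ k, sgn (ε k) * h k x| ^ p.toReal) ∂m0 := by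
  simp_rw [NN_rpow_lin h0 ht]
  have hm : ∀ k, Measurable (h k) := fun k => (h k).measurable
  rw [← lintegral_finsetSum]
  · refine lintegral_congr fun x => ?_
    rw [ENNReal.ofReal_sum_of_nonneg]
    intro ε _
    positivity
  · intro ε _
    fun_prop

/-- bounded by the indicator of the `i`-th interval -/
def Bd (i : ℕ) (G : A0) : Prop := ∀ᵐ x ∂m0, |G x| ≤ (II i).indicator (fun _ => (1:ℝ)) x

lemma Bd.sum {m : ℕ} {G : ℕ → A0} (hG : ∀ i, Bd i (G i)) (ε : Fin m → Bool) :
    ∀ᵐ x ∂m0, |∑ i : Fin m, sgn (ε i) * G i x| ≤ (Set.Ioc (0:ℝ) m).indicator (fun _ => (1:ℝ)) x := by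
  filter_upwards [ae_all_iff.2 hG] with x hx
  by_cases h : ∃ i : Fin m, x ∈ II i
  · obtain ⟨i, hi⟩ := h
    rw [Finset.sum_eq_single i]
    · rw [abs_mul, sgn_abs, one_mul]
      refine (hx i).trans ?_
      rw [Set.indicator_of_mem hi, Set.indicator_of_mem]
      refine ⟨lt_of_le_of_lt (by positivity) hi.1, hi.2.trans ?_⟩
      exact_mod_cast i.2
    · intro j _ hj
      have := hx j
      rw [Set.indicator_of_notMem, ] at this
      · rw [abs_nonpos_iff.1 this, mul_zero]
      · intro hj'
        apply hj
        apply Fin.ext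
        have h1 : (i:ℝ) < j + 1 := hi.1.trans_le hj'.2
        have h2 : (j:ℝ) < i + 1 := hj'.1.trans_le hi.2
        have h1' : (i:ℕ) < j + 1 := by exact_mod_cast h1
        have h2' : (j:ℕ) < i + 1 := by exact_mod_cast h2
        omega
    · simp
  · push Not at h
    rw [Finset.sum_eq_zero]
    · simp only [abs_zero]
      exact Set.indicator_nonneg (fun _ _ => zero_le_one) _
    · intro i _
      have := hx i
      rw [Set.indicator_of_notMem (h i)] at this
      rw [abs_nonpos_iff.1 this, mul_zero]

lemma Bd.NN_sum_le {m : ℕ} (hm : 1 ≤ m) {G : ℕ → A0} (hG : ∀ i, Bd i (G i)) (ε : Fin m → Bool)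
    {r : ℝ≥0∞} (hr : r ≠ 0) :
    NN r (∑ i : Fin m, sgn (ε i) • G i) ≤ ENNReal.ofReal ((m:ℝ) ^ (1 / r.toReal)) := by
  have hm' : (0:ℝ) < m := by exact_mod_cast hm
  have := NN_chi hr 0 m le_rfl hm'
  rw [sub_zero] at this
  rw [← this]
  apply NN_mono
  filter_upwards [Bd.sum hG ε, chi_coe (Set.Ioc (0:ℝ) m) measurableSet_Ioc,
    coeFn_lin Finset.univ (fun i : Fin m => sgn (ε i)) (fun i : Fin m => G i)] with x h1 h2 h3
  rw [h2, h3]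
  exact h1.trans (le_abs_self _)

lemma exists_trunc {p : ℝ≥0∞} (h0 : p ≠ 0) (ht : p ≠ ∞) (N : ℕ) (f : A0) (δ : ℝ) (hδ : 0 < δ)
    (h : ENNReal.ofReal δ ≤ NN p (cut (Set.Ioi (N:ℝ)) measurableSet_Ioi f)) :
    ∃ N' : ℕ, N ≤ N' ∧ ENNReal.ofReal ((δ / 2) ^ p.toReal) ≤
      ∫⁻ x in Set.Ioc (N:ℝ) N', ENNReal.ofReal (|f x| ^ p.toReal) ∂m0 := by
  have hp : 0 < p.toReal := ENNReal.toReal_pos h0 ht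
  set ν := m0.withDensity (fun x => ENNReal.ofReal (|f x| ^ p.toReal)) with hν
  have hmono : Monotone fun n : ℕ => Set.Ioc (N:ℝ) n := by
    intro a b hab
    exact Set.Ioc_subset_Ioc_right (by exact_mod_cast hab)
  have h1 := tendsto_measure_iUnion_atTop (μ := ν) hmono
  have h2 : ⋃ n : ℕ, Set.Ioc (N:ℝ) n = Set.Ioi (N:ℝ) := by
    ext x
    simp only [Set.mem_iUnion, Set.mem_Ioc, Set.mem_Ioi]
    constructor
    · rintro ⟨_, h, _⟩; exact h
    · intro h
      obtain ⟨n, hn⟩ := exists_nat_ge x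
      exact ⟨n, h, hn⟩
  rw [h2] at h1
  have h3 : ENNReal.ofReal ((δ / 2) ^ p.toReal) < ν (Set.Ioi (N:ℝ)) := by
    rw [hν, withDensity_apply _ measurableSet_Ioi, ← NN_cut_rpow h0 ht _ measurableSet_Ioi]
    refine lt_of_lt_of_le ?_ (ENNReal.rpow_le_rpow h hp.le)
    rw [ENNReal.ofReal_rpow_of_pos hδ, ENNReal.ofReal_lt_ofReal_iff (by positivity)]
    exact Real.rpow_lt_rpow (by positivity) (by linarith) hp
  obtain ⟨N', h4, h5⟩ := ((h1.eventually_const_lt h3).and (Filter.eventually_ge_atTop N)).exists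
  refine ⟨N', h5, ?_⟩
  simp only [Function.comp] at h4
  rw [hν, withDensity_apply _ measurableSet_Ioc] at h4
  exact h4.le

/-- final step A -/
lemma final_A {p q : ℝ≥0∞} (hp : 1 ≤ p) (hpq : p < q) {C : ℝ} {τ σ : A0 →ₗ[ℝ] A0}
    (D : Dat p q C τ σ) (δ : ℝ) (hδ : 0 < δ)
    (H : ∀ i N : ℕ, ∃ G, Bd i G ∧
      ENNReal.ofReal δ ≤ NN p (cut (Set.Ioi (N:ℝ)) measurableSet_Ioi (τ G))) : False := by
  have ht : p ≠ ∞ := (hpq.trans_le le_top).ne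
  have h0 : p ≠ 0 := (zero_lt_one.trans_le hp).ne'
  have hP : 0 < p.toReal := ENNReal.toReal_pos h0 ht
  have hP1 : 1 ≤ p.toReal := by
    have := ENNReal.toReal_mono ht hp
    simpa using this
  have H' : ∀ i N : ℕ, ∃ G : A0, ∃ N' : ℕ, Bd i G ∧ N ≤ N' ∧ ENNReal.ofReal ((δ / 2) ^ p.toReal) ≤
      ∫⁻ x in Set.Ioc (N:ℝ) N', ENNReal.ofReal (|τ G x| ^ p.toReal) ∂m0 := by
    intro i N
    obtain ⟨G, h1, h2⟩ := H i N
    obtain ⟨N', h3, h4⟩ := exists_trunc h0 ht N (τ G) δ hδ h2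
    exact ⟨G, N', h1, h3, h4⟩
  choose g n hg1 hg2 hg3 using H'
  let M : ℕ → ℕ := fun i => Nat.rec (motive := fun _ => ℕ) 0 (fun i N => n i N) i
  have hM : ∀ i, M (i+1) = n i (M i) := fun i => rfl
  have hMm : Monotone (fun i : ℕ => ((M i : ℕ) : ℝ)) := by
    apply monotone_nat_of_le_succ
    intro i
    rw [hM]
    exact_mod_cast hg2 i (M i)
  let G : ℕ → A0 := fun i => g i (M i)
  have hG : ∀ i, Bd i (G i) := fun i => hg1 i (M i)
  have hG3 : ∀ i, ENNReal.ofReal ((δ / 2) ^ p.toReal) ≤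
      ∫⁻ x in Set.Ioc (M i:ℝ) (M (i+1)), ENNReal.ofReal (|τ (G i) x| ^ p.toReal) ∂m0 :=
    fun i => hg3 i (M i)
  have hdis := hMm.pairwise_disjoint_on_Ioc_succ
  apply no_growth (a := (δ/2) ^ p.toReal) (b := C ^ p.toReal) (s := 1 / q.toReal * p.toReal) (t := 1)
    (by positivity)
  · have := inv_toReal_lt hp hpq
    calc 1 / q.toReal * p.toReal < 1 / p.toReal * p.toReal := by gcongr
      _ = 1 := by field_simp
  intro m hm
  have hC : 0 ≤ C := zero_le_one.trans D.one_le
  -- upper estimate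
  have hup : ∑ ε : Fin m → Bool, NN p (∑ k : Fin m, sgn (ε k) • τ (G k)) ^ p.toReal ≤
      ENNReal.ofReal (2 ^ m * (C * (m:ℝ) ^ (1 / q.toReal)) ^ p.toReal) := by
    have : ∀ ε : Fin m → Bool, NN p (∑ k : Fin m, sgn (ε k) • τ (G k)) ^ p.toReal ≤
        ENNReal.ofReal ((C * (m:ℝ) ^ (1 / q.toReal)) ^ p.toReal) := by
      intro ε
      rw [← ENNReal.ofReal_rpow_of_nonneg (by positivity) hP.le]
      gcongr
      have e : ∑ k : Fin m, sgn (ε k) • τ (G k) = τ (∑ k : Fin m, sgn (ε k) • G k) := by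
        simp [map_sum]
      rw [e, ENNReal.ofReal_mul hC]
      refine (D.tpq _).trans ?_
      gcongr
      exact Bd.NN_sum_le hm hG ε (h0.bot_lt.trans hpq).ne'
    refine (Finset.sum_le_sum fun ε _ => this ε).trans ?_
    rw [Finset.sum_const, ENNReal.ofReal_mul (by positivity)]
    simp
  have hlow : ENNReal.ofReal (2 ^ m * (m * (δ / 2) ^ p.toReal)) ≤
      ∑ ε : Fin m → Bool, NN p (∑ k : Fin m, sgn (ε k) • τ (G k)) ^ p.toReal := by
    rw [sum_NN_rpow h0 ht]
    calc ENNReal.ofReal (2 ^ m * (m * (δ / 2) ^ p.toReal)) =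
        ∑ i ∈ Finset.range m, ENNReal.ofReal (2 ^ m) * ENNReal.ofReal ((δ / 2) ^ p.toReal) := by
          rw [Finset.sum_const, ENNReal.ofReal_mul (by positivity), ENNReal.ofReal_mul (by positivity)]
          simp; ring
      _ ≤ ∑ i ∈ Finset.range m, ∫⁻ x in Set.Ioc (M i:ℝ) (M (i+1)),
          ENNReal.ofReal (∑ ε : Fin m → Bool, |∑ k : Fin m, sgn (ε k) * τ (G k) x| ^ p.toReal) ∂m0 := by
          refine Finset.sum_le_sum fun i hi => ?_
          refine (mul_le_mul_right (hG3 i) _).trans ?_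
          rw [← lintegral_const_mul' _ _ ENNReal.ofReal_ne_top]
          refine lintegral_mono fun x => ?_
          rw [← ENNReal.ofReal_mul (by positivity)]
          apply ENNReal.ofReal_le_ofReal
          have := coeff_le_avg p.toReal hP1 (fun k : Fin m => τ (G k) x)
            ⟨i, Finset.mem_range.1 hi⟩
          simpa using this
      _ = ∫⁻ x in ⋃ i ∈ Finset.range m, Set.Ioc (M i:ℝ) (M (i+1)),
          ENNReal.ofReal (∑ ε : Fin m → Bool, |∑ k : Fin m, sgn (ε k) * τ (G k) x| ^ p.toReal) ∂m0 := by
          rw [lintegral_biUnion_finset]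
          · exact fun i _ j _ hij => hdis hij
          · exact fun i _ => measurableSet_Ioc
      _ ≤ _ := setLIntegral_le_lintegral _ _
  have := hlow.trans hup
  rw [ENNReal.ofReal_le_ofReal_iff (by positivity), mul_le_mul_iff_right₀ (by positivity),
    Real.mul_rpow hC (by positivity), ← Real.rpow_mul (by positivity)] at this
  simpa [mul_comm] using this

/-! ### Step functions -/

abbrev pc (i n k : ℕ) : Set ℝ := Set.Ioc ((i:ℝ) + k / n) (i + (k + 1) / n)

/-- step function on the `i`-th interval with `n` equal pieces -/
def st (i n : ℕ) (c : Fin n → ℝ) : A0 := ∑ k : Fin n, c k • chi (pc i n k) measurableSet_Ioc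

lemma pc_sub (i n : ℕ) (hn : 1 ≤ n) (k : Fin n) : pc i n k ⊆ II i := by
  have hn' : (0:ℝ) < n := by exact_mod_cast hn
  intro x hx
  refine ⟨lt_of_le_of_lt ?_ hx.1, hx.2.trans ?_⟩
  · have : (0:ℝ) ≤ (k:ℝ) / n := by positivity
    linarith
  · gcongr
    rw [div_le_one hn']
    exact_mod_cast k.2

lemma pc_mono (i n : ℕ) : Monotone (fun k : ℕ => (i:ℝ) + k / n) := by
  intro a b h
  have : (a:ℝ) ≤ b := by exact_mod_cast h
  dsimp only
  gcongr

lemma pc_disj (i n : ℕ) : Pairwise (Function.onFun Disjoint fun k : Fin n => pc i n k) := by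
  have := (pc_mono i n).pairwise_disjoint_on_Ioc_succ
  intro a b hab
  have h := this (fun h => hab (Fin.ext h))
  simpa [Function.onFun, pc, Nat.succ_eq_add_one] using h

lemma pc_union (i n : ℕ) (hn : 1 ≤ n) : ⋃ k : Fin n, pc i n k = II i := by
  have hn' : (0:ℝ) < n := by exact_mod_cast hn
  apply Set.Subset.antisymm
  · exact Set.iUnion_subset fun k => pc_sub i n hn k
  · intro x hx
    have h0 : 0 < (x - i) * n := mul_pos (by linarith [hx.1]) hn'
    have h1 : (x - i) * n ≤ n := by nlinarith [hx.2]
    have h2 : 1 ≤ ⌈(x - i) * n⌉₊ := Nat.one_le_iff_ne_zero.2 (Nat.ceil_pos.2 h0).ne'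
    have h3 : ⌈(x - i) * n⌉₊ ≤ n := Nat.ceil_le.2 h1
    have h4 := Nat.ceil_lt_add_one h0.le
    have h5 := Nat.le_ceil ((x - i) * n)
    refine Set.mem_iUnion.2 ⟨⟨⌈(x - i) * n⌉₊ - 1, by omega⟩, ?_⟩
    have h6 : ((⌈(x - i) * n⌉₊ - 1 : ℕ) : ℝ) = (⌈(x - i) * n⌉₊ : ℝ) - 1 := by
      rw [Nat.cast_sub h2]; simp
    simp only [pc, Set.mem_Ioc, h6]
    constructor
    · rw [← lt_sub_iff_add_lt', div_lt_iff₀ hn']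
      linarith
    · rw [← sub_le_iff_le_add', le_div_iff₀ hn']
      linarith

lemma st_coe (i n : ℕ) (hn : 1 ≤ n) (c : Fin n → ℝ) :
    ∀ᵐ x ∂m0, (∀ k : Fin n, x ∈ pc i n k → st i n c x = c k) ∧ (x ∉ II i → st i n c x = 0) := by
  filter_upwards [coeFn_lin Finset.univ c (fun k : Fin n => chi (pc i n k) measurableSet_Ioc),
    ae_all_iff.2 (fun k : Fin n => chi_coe (pc i n k) measurableSet_Ioc)] with x h1 h2
  constructor
  · intro k hk
    rw [st, h1, Finset.sum_eq_single k]
    · rw [h2, Set.indicator_of_mem hk, mul_one]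
    · intro j _ hj
      rw [h2, Set.indicator_of_notMem, mul_zero]
      exact fun h => (Set.disjoint_left.1 (pc_disj i n hj)) h hk
    · simp
  · intro hx
    rw [st, h1]
    apply Finset.sum_eq_zero
    intro k _
    rw [h2, Set.indicator_of_notMem, mul_zero]
    exact fun h => hx (pc_sub i n hn k h)

lemma st_Bd (i n : ℕ) (hn : 1 ≤ n) (c : Fin n → ℝ) (hc : ∀ k, |c k| ≤ 1) : Bd i (st i n c) := by
  filter_upwards [st_coe i n hn c] with x hx
  by_cases h : x ∈ II i
  · rw [Set.indicator_of_mem h]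
    rw [← pc_union i n hn] at h
    obtain ⟨k, hk⟩ := Set.mem_iUnion.1 h
    rw [hx.1 k hk]
    exact hc k
  · rw [hx.2 h, Set.indicator_of_notMem h, abs_zero]

lemma m0_pc (i n : ℕ) (k : ℕ) : m0 (pc i n k) = ENNReal.ofReal (1 / n) := by
  rw [m0_Ioc _ _ (by positivity)]
  congr 1
  ring

lemma st_lint (i n : ℕ) (hn : 1 ≤ n) (c : Fin n → ℝ) (φ : ℝ → ℝ≥0∞) :
    ∫⁻ x in II i, φ (st i n c x) ∂m0 = ENNReal.ofReal (1 / n) * ∑ k, φ (c k) := by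
  rw [← pc_union i n hn, lintegral_iUnion (fun k => measurableSet_Ioc) (pc_disj i n), tsum_fintype,
    Finset.mul_sum]
  refine Finset.sum_congr rfl fun k _ => ?_
  have : ∀ᵐ x ∂(m0.restrict (pc i n k)), φ (st i n c x) = φ (c k) := by
    rw [ae_restrict_iff' measurableSet_Ioc]
    filter_upwards [st_coe i n hn c] with x hx hk
    rw [hx.1 k hk]
  rw [lintegral_congr_ae this, lintegral_const, Measure.restrict_apply_univ, m0_pc, mul_comm]

lemma JJ_st (i n : ℕ) (hn : 1 ≤ n) (c : Fin n → ℝ) :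
    JJ i (st i n c) = ENNReal.ofReal (1 / n * ∑ k, |c k|) := by
  unfold JJ
  rw [eLpNorm_one_eq_lintegral_enorm, st_lint i n hn c (fun y => ‖y‖ₑ),
    ENNReal.ofReal_mul (by positivity), ENNReal.ofReal_sum_of_nonneg (fun _ _ => abs_nonneg _)]
  simp [Real.enorm_eq_ofReal_abs]

lemma JJ_st_one (i n : ℕ) (hn : 1 ≤ n) (c : Fin n → ℝ) (hc : ∀ k, |c k| = 1) :
    JJ i (st i n c) = 1 := by
  have hn' : (n:ℝ) ≠ 0 := by exact_mod_cast (Nat.one_le_iff_ne_zero.1 hn)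
  rw [JJ_st i n hn]
  simp [hc, hn']

lemma NN_st_rpow {p : ℝ≥0∞} (h0 : p ≠ 0) (ht : p ≠ ∞) (i n : ℕ) (hn : 1 ≤ n) (c : Fin n → ℝ) :
    NN p (st i n c) ^ p.toReal = ENNReal.ofReal (1 / n * ∑ k, |c k| ^ p.toReal) := by
  have hp : 0 < p.toReal := ENNReal.toReal_pos h0 ht
  have := st_lint i n hn c (fun y => ENNReal.ofReal (|y| ^ p.toReal))
  rw [NN_rpow h0 ht, ENNReal.ofReal_mul (by positivity), ENNReal.ofReal_sum_of_nonneg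
    (fun _ _ => by positivity), ← this, ← lintegral_indicator measurableSet_Ioc]
  refine lintegral_congr_ae ?_
  filter_upwards [st_coe i n hn c] with x hx
  by_cases h : x ∈ II i
  · rw [Set.indicator_of_mem h]
  · rw [Set.indicator_of_notMem h, hx.2 h, abs_zero, Real.zero_rpow hp.ne', ENNReal.ofReal_zero]

lemma Bd.NN_le {i : ℕ} {G : A0} (hG : Bd i G) {r : ℝ≥0∞} (hr : r ≠ 0) : NN r G ≤ 1 := by
  have := NN_chi hr (i:ℝ) (i + 1) (by positivity) (by linarith)
  simp only [add_sub_cancel_left, Real.one_rpow, ENNReal.ofReal_one] at this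
  rw [← this]
  apply NN_mono
  filter_upwards [hG, chi_coe (II i) measurableSet_Ioc] with x h1 h2
  rw [h2]
  exact h1.trans (le_abs_self _)

lemma head_le {p q : ℝ≥0∞} (hp : 1 ≤ p) (hpq : p < q) (N : ℕ) (f : A0) :
    NN p (cut (Set.Ioi (N:ℝ))ᶜ measurableSet_Ioi.compl f) ≤
      ENNReal.ofReal ((N:ℝ) ^ (1 / p.toReal - 1 / q.toReal)) * NN q f := by
  have hlt := inv_toReal_lt hp hpq
  rw [NN_cut]
  refine (eLpNorm_le_eLpNorm_mul_rpow_measure_univ hpq.le f.aestronglyMeasurable.restrict).trans ?_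
  have : m0 (Set.Ioi (N:ℝ))ᶜ = ENNReal.ofReal N := by
    unfold m0
    rw [Measure.restrict_apply measurableSet_Ioi.compl, Set.compl_Ioi, Set.Iic_inter_Ioi,
      Real.volume_Ioc, sub_zero]
  rw [Measure.restrict_apply_univ, this, ENNReal.ofReal_rpow_of_nonneg (by positivity) (by linarith),
    mul_comm]
  gcongr
  exact eLpNorm_mono_measure _ Measure.restrict_le_self

lemma rpow_sum_le' {ι : Type} [Fintype ι] (a : ι → ℝ) (ha : ∀ i, 0 ≤ a i) (_hne : 1 ≤ Fintype.card ι)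
    (s : ℝ) (hs : 0 < s) :
    (∑ i, a i) ^ s ≤ (Fintype.card ι : ℝ) ^ (max s 1 - 1) * ∑ i, a i ^ s := by
  classical
  rcases le_total 1 s with h | h
  · rw [max_eq_left h]
    have := Real.rpow_sum_le_const_mul_sum_rpow Finset.univ a h
    simpa [abs_of_nonneg (ha _)] using this
  · rw [max_eq_right h, sub_self, Real.rpow_zero, one_mul]
    suffices H : ∀ t : Finset ι, (∑ i ∈ t, a i) ^ s ≤ ∑ i ∈ t, a i ^ s from H _
    intro t
    induction t using Finset.induction_on with
    | empty => simp [Real.zero_rpow hs.ne']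
    | insert j t hj ih =>
      rw [Finset.sum_insert hj, Finset.sum_insert hj]
      refine (Real.rpow_add_le_add_rpow (ha j) (Finset.sum_nonneg fun i _ => ha i) hs.le h).trans ?_
      gcongr

lemma partA_signs {p q : ℝ≥0∞} (hp : 1 ≤ p) (hpq : p < q) (hp2 : p < 2) (hq : q ≠ ∞) {C : ℝ}
    {τ σ : A0 →ₗ[ℝ] A0} (D : Dat p q C τ σ) (i : ℕ) (η : ℝ) (hη : 0 < η) :
    ∃ n : ℕ, 1 ≤ n ∧ ∃ ε : Fin n → Bool, NN q (τ (st i n fun k => sgn (ε k))) ≤ ENNReal.ofReal η := by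
  by_contra! H
  have ht : p ≠ ∞ := (hpq.trans_le le_top).ne
  have h0 : p ≠ 0 := (zero_lt_one.trans_le hp).ne'
  have hq0 : q ≠ 0 := (h0.bot_lt.trans hpq).ne'
  have hP : 0 < p.toReal := ENNReal.toReal_pos h0 ht
  have hQ : 0 < q.toReal := ENNReal.toReal_pos hq0 hq
  have hPQ : p.toReal < q.toReal := (ENNReal.toReal_lt_toReal ht hq).2 hpq
  have hP2 : p.toReal < 2 := by simpa using (ENNReal.toReal_lt_toReal ht (by simp)).2 hp2
  have hC : 0 < C := zero_lt_one.trans_le D.one_le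
  obtain ⟨B, hB, hK⟩ := khinchine_upper q.toReal hQ
  refine no_growth (a := η ^ q.toReal) (b := B * C ^ q.toReal)
    (s := max (q.toReal / 2) 1 - q.toReal / p.toReal) (t := 0) (by positivity) ?_ ?_
  · rw [sub_neg]
    apply max_lt
    · exact div_lt_div_of_pos_left hQ hP hP2
    · rwa [one_lt_div hP]
  intro n hn
  have hn' : (0:ℝ) < n := by exact_mod_cast hn
  rw [Real.rpow_zero, mul_one]
  set h : Fin n → A0 := fun k => τ (chi (pc i n k) measurableSet_Ioc) with hh
  have e : ∀ ε : Fin n → Bool, τ (st i n fun k => sgn (ε k)) = ∑ k, sgn (ε k) • h k := by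
    intro ε
    simp [st, map_sum, hh]
  have hhk : ∀ k, NN q (h k) ^ q.toReal ≤
      ENNReal.ofReal (C ^ q.toReal * (n:ℝ) ^ (-(q.toReal / p.toReal))) := by
    intro k
    have h1 := D.tqp (chi (pc i n k) measurableSet_Ioc)
    rw [NN_chi h0 _ _ (by positivity) (by gcongr; linarith), ← ENNReal.ofReal_mul hC.le] at h1
    refine (ENNReal.rpow_le_rpow h1 hQ.le).trans ?_
    rw [ENNReal.ofReal_rpow_of_nonneg _ hQ.le]
    · apply le_of_eq
      congr 1
      have e1 : (i:ℝ) + (k + 1) / n - (i + k / n) = (n:ℝ)⁻¹ := by field_simp; ring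
      rw [e1, Real.mul_rpow hC.le (by positivity), ← Real.rpow_mul (by positivity),
        Real.inv_rpow hn'.le, ← Real.rpow_neg hn'.le]
      congr 2
      ring
    · have : (0:ℝ) ≤ (i:ℝ) + (k + 1) / n - (i + k / n) := by
        have e1 : (i:ℝ) + (k + 1) / n - (i + k / n) = (n:ℝ)⁻¹ := by field_simp; ring
        rw [e1]; positivity
      positivity
  have hlow : ENNReal.ofReal (2 ^ n * η ^ q.toReal) ≤
      ∑ ε : Fin n → Bool, NN q (∑ k, sgn (ε k) • h k) ^ q.toReal := by
    have : ∀ ε ∈ (Finset.univ : Finset (Fin n → Bool)), ENNReal.ofReal (η ^ q.toReal) ≤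
        NN q (∑ k, sgn (ε k) • h k) ^ q.toReal := by
      intro ε _
      rw [← ENNReal.ofReal_rpow_of_pos hη, ← e]
      exact ENNReal.rpow_le_rpow (H n hn ε).le hQ.le
    refine le_trans ?_ (Finset.sum_le_sum this)
    rw [Finset.sum_const, ENNReal.ofReal_mul (by positivity)]
    simp
  have hup : ∑ ε : Fin n → Bool, NN q (∑ k, sgn (ε k) • h k) ^ q.toReal ≤
      ENNReal.ofReal (B * 2 ^ n * (n:ℝ) ^ (max (q.toReal / 2) 1 - 1) *
        (n * (C ^ q.toReal * (n:ℝ) ^ (-(q.toReal / p.toReal))))) := by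
    rw [sum_NN_rpow hq0 hq]
    have hm : ∀ k, Measurable (h k) := fun k => (h k).measurable
    calc _ ≤ ∫⁻ x, ENNReal.ofReal (B * 2 ^ n * (n:ℝ) ^ (max (q.toReal / 2) 1 - 1)) *
          ∑ k, ENNReal.ofReal (|h k x| ^ q.toReal) ∂m0 := by
          refine lintegral_mono fun x => ?_
          rw [← ENNReal.ofReal_sum_of_nonneg (fun _ _ => by positivity),
            ← ENNReal.ofReal_mul (by positivity)]
          apply ENNReal.ofReal_le_ofReal
          refine (hK (Fin n) (fun k => h k x)).trans ?_
          rw [Fintype.card_fin, mul_assoc (B * 2 ^ n)]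
          gcongr
          have := rpow_sum_le' (fun k => (h k x) ^ 2) (fun k => sq_nonneg _)
            (by simpa using hn) (q.toReal / 2) (by positivity)
          rw [Fintype.card_fin] at this
          refine this.trans (le_of_eq ?_)
          congr 1
          refine Finset.sum_congr rfl fun k _ => ?_
          rw [← sq_abs, ← Real.rpow_natCast, ← Real.rpow_mul (abs_nonneg _)]
          congr 1
          push_cast; ring
      _ = ENNReal.ofReal (B * 2 ^ n * (n:ℝ) ^ (max (q.toReal / 2) 1 - 1)) *
          ∑ k, NN q (h k) ^ q.toReal := by
          rw [lintegral_const_mul' _ _ ENNReal.ofReal_ne_top, lintegral_finsetSum]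
          · simp_rw [NN_rpow hq0 hq]
          · intro k _
            fun_prop
      _ ≤ _ := by
          refine (mul_le_mul_right (Finset.sum_le_sum fun k _ => hhk k) _).trans_eq ?_
          rw [Finset.sum_const, Finset.card_univ, Fintype.card_fin, nsmul_eq_mul,
            ← ENNReal.ofReal_natCast, ← ENNReal.ofReal_mul (by positivity),
            ← ENNReal.ofReal_mul (by positivity)]
  have := hlow.trans hup
  rw [ENNReal.ofReal_le_ofReal_iff (by positivity)] at this
  have e2 : B * 2 ^ n * (n:ℝ) ^ (max (q.toReal / 2) 1 - 1) *
        (n * (C ^ q.toReal * (n:ℝ) ^ (-(q.toReal / p.toReal)))) =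
      2 ^ n * (B * C ^ q.toReal * (n:ℝ) ^ (max (q.toReal / 2) 1 - q.toReal / p.toReal)) := by
    have : (n:ℝ) ^ (max (q.toReal / 2) 1 - q.toReal / p.toReal) =
        (n:ℝ) ^ (max (q.toReal / 2) 1 - 1) * n * (n:ℝ) ^ (-(q.toReal / p.toReal)) := by
      nth_rw 3 [← Real.rpow_one (n:ℝ)]
      rw [← Real.rpow_add hn', ← Real.rpow_add hn']
      congr 1
      ring
    rw [this]
    ring
  rw [e2, mul_le_mul_iff_right₀ (by positivity)] at this
  exact this

lemma partA {p q : ℝ≥0∞} (hp : 1 ≤ p) (hpq : p < q) (hp2 : p < 2) (hq : q ≠ ∞) {C : ℝ}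
    {τ σ : A0 →ₗ[ℝ] A0} (D : Dat p q C τ σ) : False := by
  have h0 : p ≠ 0 := (zero_lt_one.trans_le hp).ne'
  have hq0 : q ≠ 0 := (h0.bot_lt.trans hpq).ne'
  have hC : 0 < C := zero_lt_one.trans_le D.one_le
  refine final_A hp hpq D (1 / (4 * C)) (by positivity) fun i N => ?_
  set δ := 1 / (4 * C) with hδ
  have hδ0 : 0 < δ := by positivity
  set R := (N:ℝ) ^ (1 / p.toReal - 1 / q.toReal) with hR
  have hR0 : 0 ≤ R := by positivity
  obtain ⟨n, hn, ε, hε⟩ := partA_signs hp hpq hp2 hq D i (δ / (1 + R)) (by positivity)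
  set G := st i n fun k => sgn (ε k) with hG
  have hBd : Bd i G := st_Bd i n hn _ fun k => (sgn_abs _).le
  refine ⟨G, hBd, ?_⟩
  by_contra! hlt
  have h1 : NN p (τ G) ≤ ENNReal.ofReal (2 * δ) := by
    rw [cut_add_compl (Set.Ioi (N:ℝ)) measurableSet_Ioi (τ G)]
    refine (NN_add_le hp _ _).trans ?_
    rw [two_mul, ENNReal.ofReal_add hδ0.le hδ0.le]
    refine add_le_add hlt.le ?_
    refine (head_le hp hpq N _).trans ?_
    refine (mul_le_mul_right hε _).trans ?_
    rw [← ENNReal.ofReal_mul hR0]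
    apply ENNReal.ofReal_le_ofReal
    rw [mul_div_assoc', div_le_iff₀ (by positivity)]
    nlinarith
  have h2 : NN q (τ G) ≤ ENNReal.ofReal (2 * δ) := by
    refine hε.trans (ENNReal.ofReal_le_ofReal ?_)
    rw [div_le_iff₀ (by positivity)]
    nlinarith
  have h3 := D.JJσ hp (hp.trans hpq.le) i (τ G) _ ENNReal.ofReal_ne_top h1 h2
  rw [D.στ G ((hBd.NN_le h0).trans_lt one_lt_top) ((hBd.NN_le hq0).trans_lt one_lt_top),
    JJ_st_one i n hn _ (fun k => sgn_abs _), ← ENNReal.ofReal_mul hC.le, ENNReal.one_le_ofReal] at h3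
  rw [hδ] at h3
  field_simp at h3
  norm_num at h3

/-! ### The case `q = ∞` -/

lemma rad (p : ℝ≥0∞) (h0 : p ≠ 0) (ht : p ≠ ∞) : ∃ B : ℝ, 0 < B ∧ ∀ i K : ℕ, ∃ r : Fin K → A0,
    (∀ k, Bd i (r k)) ∧ (∀ k, JJ i (r k) = 1) ∧
    ∀ a : Fin K → ℝ, NN p (∑ k, a k • r k) ≤ ENNReal.ofReal (B * √(∑ k, a k ^ 2)) := by
  have hP : 0 < p.toReal := ENNReal.toReal_pos h0 ht
  obtain ⟨B, hB, hK⟩ := khinchine_upper p.toReal hP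
  refine ⟨B ^ (1 / p.toReal), by positivity, fun i K => ?_⟩
  let n := 2 ^ K
  have hn : 1 ≤ n := Nat.one_le_two_pow
  have hc : Fintype.card (Fin n) = Fintype.card (Fin K → Bool) := by simp [n]
  let e : Fin n ≃ (Fin K → Bool) := Fintype.equivOfCardEq hc
  refine ⟨fun k => st i n fun j => sgn (e j k), fun k => st_Bd i n hn _ fun j => (sgn_abs _).le,
    fun k => JJ_st_one i n hn _ fun j => sgn_abs _, fun a => ?_⟩
  have e1 : ∑ k, a k • st i n (fun j => sgn (e j k)) = st i n fun j => ∑ k, sgn (e j k) * a k := by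
    simp only [st, Finset.smul_sum, Finset.sum_smul]
    rw [Finset.sum_comm]
    refine Finset.sum_congr rfl fun j _ => Finset.sum_congr rfl fun k _ => ?_
    rw [smul_smul, mul_comm]
  have e2 := NN_st_rpow h0 ht i n hn (fun j => ∑ k, sgn (e j k) * a k)
  have e3 := Equiv.sum_comp e (fun ω : Fin K → Bool => |∑ k, sgn (ω k) * a k| ^ p.toReal)
  rw [← ENNReal.rpow_le_rpow_iff hP, e1, e2, e3,
    ENNReal.ofReal_rpow_of_nonneg (by positivity) hP.le]
  apply ENNReal.ofReal_le_ofReal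
  rw [Real.mul_rpow (by positivity) (by positivity), ← Real.rpow_mul hB.le, one_div_mul_cancel hP.ne',
    Real.rpow_one, Real.sqrt_eq_rpow, ← Real.rpow_mul (Finset.sum_nonneg fun _ _ => sq_nonneg _)]
  have h3 := hK (Fin K) a
  rw [Fintype.card_fin] at h3
  have hn2 : (n:ℝ) = 2 ^ K := by simp [n]
  rw [hn2, one_div_mul_eq_div, div_le_iff₀ (by positivity), one_div_mul_eq_div]
  linarith

lemma JJ_lint (i : ℕ) (f : A0) : JJ i f = ∫⁻ x in II i, ENNReal.ofReal |f x| ∂m0 := by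
  unfold JJ
  rw [eLpNorm_one_eq_lintegral_enorm]
  simp [Real.enorm_eq_ofReal_abs]

lemma card_le_of_JJ : ∃ c : ℝ, 0 < c ∧ ∀ (i : ℕ) (κ : Type) [Fintype κ] [DecidableEq κ] (w : κ → A0)
    (D : ℝ), 0 ≤ D → (∀ ε : κ → Bool, JJ i (∑ k, sgn (ε k) • w k) ≤ ENNReal.ofReal D) →
    (∀ k, ENNReal.ofReal (1/4) ≤ JJ i (w k)) → (Fintype.card κ : ℝ) ≤ (4 * D / c) ^ 2 := by
  obtain ⟨c, hc, hK⟩ := khinchine_lower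
  refine ⟨c, hc, fun i κ _ _ w D hD h1 h2 => ?_⟩
  have hm : ∀ k, Measurable (w k) := fun k => (w k).measurable
  set m := Fintype.card κ with hmdef
  have hup : ∑ ε : κ → Bool, JJ i (∑ k, sgn (ε k) • w k) ≤ ENNReal.ofReal (2 ^ m * D) := by
    refine (Finset.sum_le_sum fun ε _ => h1 ε).trans ?_
    rw [Finset.sum_const, ENNReal.ofReal_mul (by positivity)]
    simp [m]
  have hlow : ENNReal.ofReal (c * 2 ^ m * (m * (1 / 4))) ≤
      ENNReal.ofReal (√m) * ∑ ε : κ → Bool, JJ i (∑ k, sgn (ε k) • w k) := by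
    calc ENNReal.ofReal (c * 2 ^ m * (m * (1 / 4)))
        = ENNReal.ofReal (c * 2 ^ m) * ∑ k : κ, ENNReal.ofReal (1 / 4) := by
          rw [Finset.sum_const, Finset.card_univ, nsmul_eq_mul, ← ENNReal.ofReal_natCast,
            ← ENNReal.ofReal_mul (by positivity), ← ENNReal.ofReal_mul (by positivity)]
      _ ≤ ENNReal.ofReal (c * 2 ^ m) * ∑ k : κ, JJ i (w k) := by
          gcongr with k
          exact h2 k
      _ = ∫⁻ x in II i, ENNReal.ofReal (c * 2 ^ m) * ∑ k, ENNReal.ofReal |w k x| ∂m0 := by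
          rw [lintegral_const_mul' _ _ ENNReal.ofReal_ne_top, lintegral_finsetSum]
          · simp_rw [JJ_lint]
          · intro k _
            fun_prop
      _ ≤ ∫⁻ x in II i, ENNReal.ofReal (√m) *
            ENNReal.ofReal (∑ ε : κ → Bool, |∑ k, sgn (ε k) * w k x|) ∂m0 := by
          refine lintegral_mono fun x => ?_
          rw [← ENNReal.ofReal_sum_of_nonneg (fun _ _ => by positivity),
            ← ENNReal.ofReal_mul (by positivity), ← ENNReal.ofReal_mul (by positivity)]
          apply ENNReal.ofReal_le_ofReal
          have h3 := hK κ (fun k => w k x)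
          have h4 : ∑ k, |w k x| ≤ √m * √(∑ k, w k x ^ 2) := by
            rw [← Real.sqrt_mul (by positivity)]
            apply Real.le_sqrt_of_sq_le
            have := sq_sum_le_card_mul_sum_sq (s := (Finset.univ : Finset κ)) (f := fun k => |w k x|)
            simpa [m] using this
          calc c * 2 ^ m * ∑ k, |w k x| ≤ c * 2 ^ m * (√m * √(∑ k, w k x ^ 2)) := by gcongr
            _ = √m * (c * 2 ^ m * √(∑ k, w k x ^ 2)) := by ring
            _ ≤ _ := by gcongr
      _ = _ := by
          rw [lintegral_const_mul' _ _ ENNReal.ofReal_ne_top]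
          congr 1
          simp_rw [ENNReal.ofReal_sum_of_nonneg (fun (ε : κ → Bool) _ => abs_nonneg _)]
          rw [lintegral_finsetSum]
          · refine Finset.sum_congr rfl fun ε _ => ?_
            rw [JJ_lint]
            refine lintegral_congr_ae (ae_restrict_of_ae ?_)
            filter_upwards [coeFn_lin Finset.univ (fun k => sgn (ε k)) w] with x hx
            rw [hx]
          · intro ε _
            fun_prop
  have h3 := hlow.trans (mul_le_mul_right hup _)
  rw [← ENNReal.ofReal_mul (by positivity), ENNReal.ofReal_le_ofReal_iff (by positivity)] at h3
  have h4 : c * (m * (1/4)) ≤ √m * D := by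
    have : (2:ℝ) ^ m * (c * (m * (1/4))) ≤ 2 ^ m * (√m * D) := by linarith
    exact le_of_mul_le_mul_left this (by positivity)
  have hs : √(m:ℝ) * √m = m := Real.mul_self_sqrt (by positivity)
  rcases Nat.eq_zero_or_pos m with h | h
  · simp only [h]; push_cast; positivity
  have hs0 : 0 < √(m:ℝ) := Real.sqrt_pos.2 (by exact_mod_cast h)
  have h5 : √(m:ℝ) ≤ 4 * D / c := by
    rw [le_div_iff₀ hc]
    have : √(m:ℝ) * (√m * c) ≤ √m * (4 * D) := by
      rw [← mul_assoc, hs]; linarith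
    have := le_of_mul_le_mul_left this hs0
    linarith
  calc (m:ℝ) = √m ^ 2 := by rw [sq, hs]
    _ ≤ _ := by gcongr

/-- truncation keeping large values -/
def bg (t y : ℝ) : ℝ := if t < |y| then y else 0

lemma bg_meas (t : ℝ) : Measurable (bg t) := by
  unfold bg
  exact Measurable.ite (measurableSet_lt measurable_const measurable_id.abs) measurable_id
    measurable_const

lemma abs_bg_le (t y : ℝ) : |bg t y| ≤ |y| := by
  unfold bg; split_ifs <;> simp

lemma abs_sub_bg_le (t y : ℝ) : |y - bg t y| ≤ |y| := by
  unfold bg; split_ifs <;> simp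

lemma abs_sub_bg_le' (t y : ℝ) (ht : 0 ≤ t) : |y - bg t y| ≤ t := by
  unfold bg; split_ifs with h
  · simpa using ht
  · simpa using h

lemma bg_sum {ι : Type} [Fintype ι] (y : ι → ℝ) (M t : ℝ) (hM : 0 ≤ M) (ht : 0 < t)
    (h : ∀ a : ι → SignType, |∑ k, (a k : ℝ) * y k| ≤ M * √(∑ k, (a k : ℝ) ^ 2)) :
    ∑ k, |bg t (y k)| ≤ M ^ 2 / t := by
  classical
  set A := Finset.univ.filter fun k => t < |y k| with hA
  have h1 := h fun k => if t < |y k| then SignType.sign (y k) else 0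
  have e1 : ∑ k, ((if t < |y k| then SignType.sign (y k) else 0 : SignType) : ℝ) * y k =
      ∑ k, |bg t (y k)| := by
    refine Finset.sum_congr rfl fun k _ => ?_
    unfold bg
    split_ifs with hk
    · exact sign_mul_self (y k)
    · simp
  have e2 : ∑ k, ((if t < |y k| then SignType.sign (y k) else 0 : SignType) : ℝ) ^ 2 ≤ A.card := by
    rw [hA, Finset.card_filter]
    push_cast
    refine Finset.sum_le_sum fun k _ => ?_
    split_ifs with hk
    · rcases (SignType.sign (y k)) with _ | _ | _ <;> simp
    · simp
  have e3 : t * A.card ≤ ∑ k, |bg t (y k)| := by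
    rw [hA, Finset.card_filter]
    push_cast
    rw [Finset.mul_sum]
    refine Finset.sum_le_sum fun k _ => ?_
    unfold bg
    split_ifs with hk
    · simpa using hk.le
    · simp
  rw [e1, abs_of_nonneg (Finset.sum_nonneg fun _ _ => abs_nonneg _)] at h1
  have h2 : ∑ k, |bg t (y k)| ≤ M * √(A.card) :=
    h1.trans (mul_le_mul_of_nonneg_left (Real.sqrt_le_sqrt e2) hM)
  have hs : √(A.card:ℝ) * √(A.card) = A.card := Real.mul_self_sqrt (by positivity)
  rcases Nat.eq_zero_or_pos A.card with h0 | h0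
  · rw [h0] at h2
    simp only [Nat.cast_zero, Real.sqrt_zero, mul_zero] at h2
    exact h2.trans (by positivity)
  have hs0 : 0 < √(A.card:ℝ) := Real.sqrt_pos.2 (by exact_mod_cast h0)
  have h3 : √(A.card:ℝ) ≤ M / t := by
    rw [le_div_iff₀ ht]
    have : √(A.card:ℝ) * (√(A.card) * t) ≤ √(A.card) * M := by
      rw [← mul_assoc, hs]; linarith
    exact le_of_mul_le_mul_left this hs0
  calc _ ≤ M * √(A.card) := h2
    _ ≤ M * (M / t) := by gcongr
    _ = _ := by ring

/-- truncation on functions -/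
def BG (t : ℝ) (f : A0) : A0 := AEEqFun.mk (fun x => bg t (f x))
  ((bg_meas t).comp f.measurable).aestronglyMeasurable

lemma BG_coe (t : ℝ) (f : A0) : ⇑(BG t f) =ᵐ[m0] fun x => bg t (f x) := AEEqFun.coeFn_mk _ _

lemma cut_lin {ι : Type} (s : Finset ι) (E : Set ℝ) (hE : MeasurableSet E) (c : ι → ℝ) (f : ι → A0) :
    ∑ k ∈ s, c k • cut E hE (f k) = cut E hE (∑ k ∈ s, c k • f k) := by
  apply AEEqFun.ext
  have h2 : ∀ᵐ x ∂m0, ∀ k ∈ s, cut E hE (f k) x = E.indicator (f k) x := by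
    rw [Filter.eventually_all_finset]
    exact fun k _ => cut_coe E hE (f k)
  filter_upwards [coeFn_lin s c f, coeFn_lin s c (fun k => cut E hE (f k)), h2,
    cut_coe E hE (∑ k ∈ s, c k • f k)] with x h1 h2 h3 h4
  rw [h2, h4]
  by_cases h : x ∈ E
  · rw [Set.indicator_of_mem h, h1]
    refine Finset.sum_congr rfl fun k hk => ?_
    rw [h3 k hk, Set.indicator_of_mem h]
  · rw [Set.indicator_of_notMem h]
    refine Finset.sum_eq_zero fun k hk => ?_
    rw [h3 k hk, Set.indicator_of_notMem h, mul_zero]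

lemma NN_top_le {f : A0} {M : ℝ} (h : ∀ᵐ x ∂m0, |f x| ≤ M) : NN ∞ f ≤ ENNReal.ofReal M := by
  unfold NN
  rw [eLpNorm_exponent_top]
  exact eLpNormEssSup_le_of_ae_bound (by simpa using h)

lemma ae_le_of_NN_top {f : A0} {M : ℝ} (hM : 0 ≤ M) (h : NN ∞ f ≤ ENNReal.ofReal M) :
    ∀ᵐ x ∂m0, |f x| ≤ M := by
  unfold NN at h
  rw [eLpNorm_exponent_top] at h
  filter_upwards [enorm_ae_le_eLpNormEssSup (f : ℝ → ℝ) m0] with x hx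
  have := hx.trans h
  rwa [Real.enorm_eq_ofReal_abs, ENNReal.ofReal_le_ofReal_iff hM] at this

lemma big_sum_le {K : ℕ} {h : Fin K → A0} {M t : ℝ} (hM : 0 ≤ M) (ht : 0 < t)
    (H : ∀ a : Fin K → ℝ, NN ∞ (∑ k, a k • h k) ≤ ENNReal.ofReal (M * √(∑ k, a k ^ 2)))
    (A : Finset (Fin K)) (ε : A → Bool) :
    NN ∞ (∑ k : A, sgn (ε k) • BG t (h k)) ≤ ENNReal.ofReal (M ^ 2 / t) := by
  apply NN_top_le
  have h1 : ∀ a : Fin K → SignType, ∀ᵐ x ∂m0,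
      |∑ k, (a k : ℝ) * h k x| ≤ M * √(∑ k, (a k : ℝ) ^ 2) := by
    intro a
    filter_upwards [ae_le_of_NN_top (by positivity) (H fun k => (a k : ℝ)),
      coeFn_lin Finset.univ (fun k => (a k : ℝ)) h] with x h1 h2
    rwa [h2] at h1
  filter_upwards [ae_all_iff.2 h1, coeFn_lin Finset.univ (fun k : A => sgn (ε k))
    (fun k : A => BG t (h k)), ae_all_iff.2 (fun k => BG_coe t (h k))] with x h2 h3 h4
  rw [h3]
  calc |∑ k : A, sgn (ε k) * BG t (h k) x| ≤ ∑ k : A, |bg t (h k x)| := by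
        refine (Finset.abs_sum_le_sum_abs _ _).trans (Finset.sum_le_sum fun k _ => ?_)
        rw [abs_mul, sgn_abs, one_mul, h4]
    _ = ∑ k ∈ A, |bg t (h k x)| := Finset.sum_coe_sort A (fun k => |bg t (h k x)|)
    _ ≤ ∑ k, |bg t (h k x)| :=
        Finset.sum_le_sum_of_subset_of_nonneg (Finset.subset_univ A) fun _ _ _ => abs_nonneg _
    _ ≤ _ := bg_sum _ M t hM ht h2

lemma cut_mono (r : ℝ≥0∞) (E : Set ℝ) (hE : MeasurableSet E) {f g : A0} (h : ∀ᵐ x ∂m0, |f x| ≤ |g x|) :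
    NN r (cut E hE f) ≤ NN r (cut E hE g) := by
  rw [NN_cut, NN_cut]
  exact eLpNorm_mono_ae (ae_restrict_of_ae (by simpa using h))

lemma sub_BG_le (t : ℝ) (f : A0) : ∀ᵐ x ∂m0, |(f - BG t f) x| ≤ |f x| := by
  filter_upwards [AEEqFun.coeFn_sub f (BG t f), BG_coe t f] with x h1 h2
  rw [h1, Pi.sub_apply, h2]
  exact abs_sub_bg_le _ _

lemma sub_BG_le' (t : ℝ) (ht : 0 ≤ t) (f : A0) : ∀ᵐ x ∂m0, |(f - BG t f) x| ≤ t := by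
  filter_upwards [AEEqFun.coeFn_sub f (BG t f), BG_coe t f] with x h1 h2
  rw [h1, Pi.sub_apply, h2]
  exact abs_sub_bg_le' _ _ ht

lemma cut_split (E : Set ℝ) (hE : MeasurableSet E) (f g : A0) :
    cut E hE f = cut E hE g + cut E hE (f - g) := by
  apply AEEqFun.ext
  filter_upwards [cut_coe E hE f, cut_coe E hE g, cut_coe E hE (f - g), AEEqFun.coeFn_sub f g,
    AEEqFun.coeFn_add (cut E hE g) (cut E hE (f - g))] with x h1 h2 h3 h4 h5
  rw [h5, Pi.add_apply, h1, h2, h3]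
  by_cases h : x ∈ E
  · simp only [Set.indicator_of_mem h]
    rw [h4]; simp
  · simp only [Set.indicator_of_notMem h, add_zero]

lemma partC {p : ℝ≥0∞} (hp : 1 ≤ p) (ht : p < ∞) {C : ℝ}
    {τ σ : A0 →ₗ[ℝ] A0} (D : Dat p ∞ C τ σ) : False := by
  have h0 : p ≠ 0 := (zero_lt_one.trans_le hp).ne'
  have hC : 0 < C := zero_lt_one.trans_le D.one_le
  have hone : (1:ℝ≥0∞) ≤ ∞ := le_top
  obtain ⟨B, hB, hrad⟩ := rad p h0 ht.ne
  obtain ⟨c, hc, hcard⟩ := card_le_of_JJ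
  -- absolute constants
  set M : ℝ := C * B with hMdef
  have hM : 0 < M := by positivity
  set t : ℝ := 1 / (8 * C) with htdef
  have ht0 : 0 < t := by positivity
  set U : ℝ := M ^ 2 / t with hU
  have hU0 : 0 < U := by positivity
  obtain ⟨K', hK'⟩ := exists_nat_gt ((4 * (C * U) / c) ^ 2)
  have hK'0 : (0:ℝ) < K' := lt_of_le_of_lt (by positivity) hK'
  set δ : ℝ := min t (U / K') with hδdef
  have hδ : 0 < δ := lt_min ht0 (by positivity)
  refine final_A hp ht D δ hδ fun i N => ?_
  by_contra! hcon
  set R := (N:ℝ) ^ (1 / p.toReal - 1 / (∞:ℝ≥0∞).toReal) with hR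
  have hR0 : 0 ≤ R := by positivity
  have hhead : ∀ (f : A0) (b : ℝ), 0 ≤ b → NN ∞ f ≤ ENNReal.ofReal b →
      JJ i (σ (cut (Set.Ioi (N:ℝ))ᶜ measurableSet_Ioi.compl f)) ≤
        ENNReal.ofReal (C * ((1 + R) * b)) := by
    intro f b hb hf
    rw [ENNReal.ofReal_mul hC.le]
    refine D.JJσ hp hone i _ _ ENNReal.ofReal_ne_top ?_ ?_
    · refine (head_le hp ht N f).trans ((mul_le_mul_right hf _).trans ?_)
      rw [← ENNReal.ofReal_mul hR0]
      exact ENNReal.ofReal_le_ofReal (by nlinarith)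
    · exact (NN_cut_le _ _ _ _).trans (hf.trans (ENNReal.ofReal_le_ofReal (by nlinarith)))
  set s : ℝ := 1 / (8 * C * (1 + R)) with hsdef
  have hs0 : 0 < s := by positivity
  set V : ℝ := M ^ 2 / s with hV
  have hV0 : 0 < V := by positivity
  obtain ⟨K₀, hK₀⟩ := exists_nat_gt ((4 * (C * ((1 + R) * V)) / c) ^ 2)
  obtain ⟨r, hr1, hr2, hr3⟩ := hrad i (K' + K₀)
  set h : Fin (K' + K₀) → A0 := fun k => τ (r k) with hh
  have H : ∀ a : Fin (K' + K₀) → ℝ, NN ∞ (∑ k, a k • h k) ≤ ENNReal.ofReal (M * √(∑ k, a k ^ 2)) := by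
    intro a
    have e : ∑ k, a k • h k = τ (∑ k, a k • r k) := by simp [hh, map_sum]
    rw [e, hMdef, mul_assoc, ENNReal.ofReal_mul hC.le]
    exact (D.tqp _).trans (mul_le_mul_right (hr3 a) _)
  -- the four parts
  set bh : Fin (K' + K₀) → A0 := fun k => cut (Set.Ioi (N:ℝ))ᶜ measurableSet_Ioi.compl (BG s (h k)) with hbh
  set bt : Fin (K' + K₀) → A0 := fun k => cut (Set.Ioi (N:ℝ)) measurableSet_Ioi (BG t (h k)) with hbt
  set sh : Fin (K' + K₀) → A0 :=
    fun k => cut (Set.Ioi (N:ℝ))ᶜ measurableSet_Ioi.compl (h k - BG s (h k)) with hsh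
  set sl : Fin (K' + K₀) → A0 :=
    fun k => cut (Set.Ioi (N:ℝ)) measurableSet_Ioi (h k - BG t (h k)) with hsl
  have htail : ∀ k, NN p (cut (Set.Ioi (N:ℝ)) measurableSet_Ioi (h k)) ≤ ENNReal.ofReal δ :=
    fun k => (hcon (r k) (hr1 k)).le
  have hJsh : ∀ k, JJ i (σ (sh k)) ≤ ENNReal.ofReal (1/8) := by
    intro k
    refine (hhead _ s hs0.le (NN_top_le (sub_BG_le' s hs0.le (h k)))).trans
      (ENNReal.ofReal_le_ofReal ?_)
    rw [hsdef]; apply le_of_eq; field_simp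
  have hJsl : ∀ k, JJ i (σ (sl k)) ≤ ENNReal.ofReal (1/8) := by
    intro k
    have e : (1/8:ℝ) = C * t := by rw [htdef]; field_simp
    rw [e, ENNReal.ofReal_mul hC.le]
    refine D.JJσ hp hone i _ _ ENNReal.ofReal_ne_top ?_ ?_
    · exact (cut_mono _ _ _ (sub_BG_le t (h k))).trans ((htail k).trans
        (ENNReal.ofReal_le_ofReal (min_le_left _ _)))
    · exact (NN_cut_le _ _ _ _).trans (NN_top_le (sub_BG_le' t ht0.le (h k)))
  have hdec : ∀ k, h k = (bh k + sh k) + (bt k + sl k) := by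
    intro k
    rw [hbh, hsh, hbt, hsl]
    dsimp only
    rw [← cut_split, ← cut_split, add_comm]
    exact cut_add_compl _ _ _
  -- bad indices
  set Ah := Finset.univ.filter fun k => ENNReal.ofReal (1/4) ≤ JJ i (σ (bh k)) with hAh
  set At := Finset.univ.filter fun k => ENNReal.ofReal (1/4) ≤ JJ i (σ (bt k)) with hAt
  have hAh1 : Ah.card < K₀ := by
    have := hcard i Ah (fun k => σ (bh k)) (C * ((1 + R) * V)) (by positivity) ?_ ?_
    · rw [Fintype.card_coe] at this
      exact_mod_cast this.trans_lt hK₀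
    · intro ε
      have e : ∑ k : Ah, sgn (ε k) • σ (bh k) = σ (∑ k : Ah, sgn (ε k) • bh k) := by simp [map_sum]
      rw [e, hbh]
      dsimp only
      rw [cut_lin]
      exact hhead _ V hV0.le (big_sum_le hM.le hs0 H Ah ε)
    · intro k
      exact (Finset.mem_filter.1 k.2).2
  have hAt1 : At.card < K' := by
    by_contra! hge
    obtain ⟨A, hA, hA'⟩ := Finset.exists_subset_card_eq hge
    have := hcard i A (fun k => σ (bt k)) (C * U) (by positivity) ?_ ?_
    · rw [Fintype.card_coe, hA'] at this
      linarith
    · intro ε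
      have e : ∑ k : A, sgn (ε k) • σ (bt k) = σ (∑ k : A, sgn (ε k) • bt k) := by simp [map_sum]
      rw [e, ENNReal.ofReal_mul hC.le]
      refine D.JJσ hp hone i _ _ ENNReal.ofReal_ne_top ?_ ?_
      · refine (NN_sum_le hp _ _).trans ?_
        have : ∀ k ∈ (Finset.univ : Finset A), NN p (sgn (ε k) • bt k) ≤ ENNReal.ofReal (U / K') := by
          intro k _
          rw [NN_smul, Real.enorm_eq_ofReal_abs, sgn_abs, ENNReal.ofReal_one, one_mul]
          refine le_trans (cut_mono _ _ _ ?_) ((htail k).trans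
            (ENNReal.ofReal_le_ofReal (min_le_right _ _)))
          filter_upwards [BG_coe t (h k)] with x hx
          rw [hx]
          exact abs_bg_le _ _
        refine (Finset.sum_le_sum this).trans ?_
        rw [Finset.sum_const, Finset.card_univ, Fintype.card_coe, hA', nsmul_eq_mul,
          ← ENNReal.ofReal_natCast, ← ENNReal.ofReal_mul (by positivity)]
        apply ENNReal.ofReal_le_ofReal
        apply le_of_eq; field_simp
      · rw [hbt]
        dsimp only
        rw [cut_lin]
        exact (NN_cut_le _ _ _ _).trans (big_sum_le hM.le ht0 H A ε)
    · intro k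
      exact (Finset.mem_filter.1 (hA k.2)).2
  obtain ⟨k, hk⟩ : ∃ k, k ∉ Ah ∪ At := by
    by_contra! hall
    have h1 := Finset.card_union_le Ah At
    rw [Finset.eq_univ_iff_forall.2 hall] at h1
    simp at h1
    omega
  have hk1 : JJ i (σ (bh k)) ≤ ENNReal.ofReal (1/4) := by
    by_contra! hlt
    exact hk (Finset.mem_union_left _ (Finset.mem_filter.2 ⟨Finset.mem_univ _, hlt.le⟩))
  have hk2 : JJ i (σ (bt k)) ≤ ENNReal.ofReal (1/4) := by
    by_contra! hlt
    exact hk (Finset.mem_union_right _ (Finset.mem_filter.2 ⟨Finset.mem_univ _, hlt.le⟩))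
  have hfin : JJ i (r k) ≤ ENNReal.ofReal (3/4) := by
    have e : r k = σ (h k) :=
      (D.στ _ (((hr1 k).NN_le h0).trans_lt one_lt_top) (((hr1 k).NN_le top_ne_zero).trans_lt
        one_lt_top)).symm
    rw [e, hdec k, map_add, map_add, map_add]
    refine (JJ_add_le _ _ _).trans ?_
    refine (add_le_add (JJ_add_le _ _ _) (JJ_add_le _ _ _)).trans ?_
    refine (add_le_add (add_le_add hk1 (hJsh k)) (add_le_add hk2 (hJsl k))).trans ?_
    rw [← ENNReal.ofReal_add (by norm_num) (by norm_num),
      ← ENNReal.ofReal_add (by norm_num) (by norm_num)]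
    exact ENNReal.ofReal_le_ofReal (by norm_num)
  rw [hr2 k, ENNReal.one_le_ofReal] at hfin
  norm_num at hfin

/-! ### The case `2 ≤ p < q < ∞` -/

/-- bounded by the indicator of an interval -/
def Sup (a b : ℝ) (G : A0) : Prop := ∀ᵐ x ∂m0, |G x| ≤ (Set.Ioc a b).indicator (fun _ => (1:ℝ)) x

/-- pairing -/
def pr (G g : A0) : ℝ := ∫ x, G x * g x ∂m0

lemma Sup.lint_le {a b : ℝ} {G : A0} (hG : Sup a b G) (ha : 0 ≤ a) (hab : a < b) {r : ℝ≥0∞}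
    (hr : 1 ≤ r) (g : A0) : ∫⁻ x, ‖G x * g x‖ₑ ∂m0 ≤
      ENNReal.ofReal ((b - a) ^ (1 - 1 / r.toReal)) * NN r g := by
  have h1 : ∫⁻ x, ‖G x * g x‖ₑ ∂m0 ≤ eLpNorm (g : ℝ → ℝ) 1 (m0.restrict (Set.Ioc a b)) := by
    rw [eLpNorm_one_eq_lintegral_enorm, ← lintegral_indicator measurableSet_Ioc]
    refine lintegral_mono_ae ?_
    filter_upwards [hG] with x hx
    by_cases h : x ∈ Set.Ioc a b
    · rw [Set.indicator_of_mem h] at hx ⊢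
      rw [enorm_mul, Real.enorm_eq_ofReal_abs (G x)]
      calc _ ≤ 1 * ‖g x‖ₑ := by
            gcongr
            exact ENNReal.ofReal_le_one.2 hx
        _ = _ := one_mul _
    · rw [Set.indicator_of_notMem h] at hx ⊢
      rw [abs_nonpos_iff.1 hx]; simp
  refine h1.trans ((eLpNorm_le_eLpNorm_mul_rpow_measure_univ hr
    g.aestronglyMeasurable.restrict).trans ?_)
  rw [Measure.restrict_apply_univ, m0_Ioc a b ha, ENNReal.ofReal_rpow_of_pos (by linarith), mul_comm]
  simp only [ENNReal.toReal_one, one_div, inv_one]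
  gcongr
  exact eLpNorm_mono_measure _ Measure.restrict_le_self

lemma Sup.pr_le {a b : ℝ} {G : A0} (hG : Sup a b G) (ha : 0 ≤ a) (hab : a < b) {r : ℝ≥0∞}
    (hr : 1 ≤ r) (g : A0) : ENNReal.ofReal |pr G g| ≤
      ENNReal.ofReal ((b - a) ^ (1 - 1 / r.toReal)) * NN r g := by
  rw [← Real.enorm_eq_ofReal_abs]
  exact (enorm_integral_le_lintegral_enorm _).trans (hG.lint_le ha hab hr g)

lemma Sup.int {a b : ℝ} {G : A0} (hG : Sup a b G) (ha : 0 ≤ a) (hab : a < b) {r : ℝ≥0∞}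
    (hr : 1 ≤ r) (g : A0) (hg : NN r g < ∞) : Integrable (fun x => G x * g x) m0 := by
  refine ⟨G.aestronglyMeasurable.mul g.aestronglyMeasurable, ?_⟩
  exact lt_of_le_of_lt (hG.lint_le ha hab hr g) (ENNReal.mul_lt_top ENNReal.ofReal_lt_top hg)

lemma pr_lin_right {ι : Type} (s : Finset ι) (c : ι → ℝ) (G : A0) (g : ι → A0)
    (h : ∀ k ∈ s, Integrable (fun x => G x * g k x) m0) :
    pr G (∑ k ∈ s, c k • g k) = ∑ k ∈ s, c k * pr G (g k) := by
  unfold pr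
  have : ∀ᵐ x ∂m0, G x * (∑ k ∈ s, c k • g k : A0) x = ∑ k ∈ s, c k * (G x * g k x) := by
    filter_upwards [coeFn_lin s c g] with x hx
    rw [hx, Finset.mul_sum]
    exact Finset.sum_congr rfl fun k _ => by ring
  rw [integral_congr_ae this, integral_finsetSum _ fun k hk => (h k hk).const_mul _]
  exact Finset.sum_congr rfl fun k _ => integral_const_mul _ _

lemma pr_comm (G g : A0) : pr G g = pr g G := by
  unfold pr
  simp_rw [mul_comm]

lemma pr_lin_left {ι : Type} (s : Finset ι) (c : ι → ℝ) (G : ι → A0) (g : A0)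
    (h : ∀ k ∈ s, Integrable (fun x => G k x * g x) m0) :
    pr (∑ k ∈ s, c k • G k) g = ∑ k ∈ s, c k * pr (G k) g := by
  rw [pr_comm, pr_lin_right]
  · simp_rw [pr_comm]
  · intro k hk
    simpa [mul_comm] using h k hk

lemma pr_add {G f g : A0} (hf : Integrable (fun x => G x * f x) m0)
    (hg : Integrable (fun x => G x * g x) m0) : pr G (f + g) = pr G f + pr G g := by
  unfold pr
  rw [← integral_add hf hg]
  refine integral_congr_ae ?_
  filter_upwards [AEEqFun.coeFn_add f g] with x hx
  rw [hx, Pi.add_apply, mul_add]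

lemma sum_rpow_le_rpow_sum {ι : Type} [Fintype ι] (a : ι → ℝ) (ha : ∀ i, 0 ≤ a i) (s : ℝ)
    (hs : 1 ≤ s) : ∑ i, a i ^ s ≤ (∑ i, a i) ^ s := by
  have hS : 0 ≤ ∑ i, a i := Finset.sum_nonneg fun i _ => ha i
  have h1 : ∀ i, a i ^ s ≤ a i * (∑ i, a i) ^ (s - 1) := by
    intro i
    have hle : a i ≤ ∑ i, a i := Finset.single_le_sum (fun i _ => ha i) (Finset.mem_univ i)
    rcases (ha i).eq_or_lt with h | h
    · rw [← h, Real.zero_rpow (by linarith), zero_mul]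
    · have : a i ^ s = a i * a i ^ (s - 1) := by
        nth_rw 2 [← Real.rpow_one (a i)]
        rw [← Real.rpow_add h]; congr 1; ring
      rw [this]
      gcongr
  refine (Finset.sum_le_sum fun i _ => h1 i).trans ?_
  rw [← Finset.sum_mul]
  rcases hS.eq_or_lt with h | h
  · rw [← h, zero_mul, Real.zero_rpow (by linarith)]
  · apply le_of_eq
    nth_rw 1 [← Real.rpow_one (∑ i, a i)]
    rw [← Real.rpow_add h]; congr 1; ring

lemma bessel {ι : Type} [Fintype ι] [DecidableEq ι] (y : (ι → Bool) → ℝ) :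
    ∑ k, (∑ ε : ι → Bool, sgn (ε k) * y ε) ^ 2 ≤ 2 ^ Fintype.card ι * ∑ ε, y ε ^ 2 := by
  set W : ι → ℝ := fun k => ∑ ε : ι → Bool, sgn (ε k) * y ε with hW
  have h1 : ∑ ε : ι → Bool, y ε * (∑ k, sgn (ε k) * W k) = ∑ k, W k ^ 2 := by
    simp_rw [Finset.mul_sum]
    rw [Finset.sum_comm]
    refine Finset.sum_congr rfl fun k _ => ?_
    rw [sq]
    nth_rw 2 [hW]
    dsimp only
    rw [Finset.sum_mul]
    exact Finset.sum_congr rfl fun ε _ => by ring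
  have h2 := sum_sq_sgn W
  have h3 := Finset.sum_mul_sq_le_sq_mul_sq Finset.univ y (fun ε : ι → Bool => ∑ k, sgn (ε k) * W k)
  rw [h1, h2] at h3
  change ∑ k, W k ^ 2 ≤ _
  rcases (Finset.sum_nonneg fun k (_ : k ∈ Finset.univ) => sq_nonneg (W k)).eq_or_lt with h | h
  · rw [← h]
    exact mul_nonneg (by positivity) (Finset.sum_nonneg fun _ _ => sq_nonneg _)
  · refine le_of_mul_le_mul_right ?_ h
    nlinarith

lemma bessel_rpow {ι : Type} [Fintype ι] [DecidableEq ι] (y : (ι → Bool) → ℝ) (P : ℝ) (hP : 2 ≤ P) :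
    ∑ k, |∑ ε : ι → Bool, sgn (ε k) * y ε| ^ P ≤
      ((2:ℝ) ^ Fintype.card ι) ^ (P - 1) * ∑ ε, |y ε| ^ P := by
  have hsq : ∀ z : ℝ, |z| ^ P = (z ^ 2) ^ (P / 2) := by
    intro z
    rw [← sq_abs, ← Real.rpow_natCast, ← Real.rpow_mul (abs_nonneg _)]
    congr 1
    push_cast; ring
  simp_rw [hsq]
  refine (sum_rpow_le_rpow_sum _ (fun k => sq_nonneg _) (P / 2) (by linarith)).trans ?_
  refine (Real.rpow_le_rpow (Finset.sum_nonneg fun _ _ => sq_nonneg _) (bessel y)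
    (by linarith)).trans ?_
  rw [Real.mul_rpow (by positivity) (Finset.sum_nonneg fun _ _ => sq_nonneg _)]
  have h1 := Real.rpow_sum_le_const_mul_sum_rpow_of_nonneg (Finset.univ : Finset (ι → Bool))
    (f := fun ε => y ε ^ 2) (p := P / 2) (by linarith) (fun _ _ => sq_nonneg _)
  have h2 : ((Finset.univ : Finset (ι → Bool)).card : ℝ) = 2 ^ Fintype.card ι := by simp
  rw [h2] at h1
  refine (mul_le_mul_of_nonneg_left h1 (by positivity)).trans (le_of_eq ?_)
  rw [← mul_assoc, ← Real.rpow_add (by positivity)]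
  congr 2
  ring

lemma sup_pc (i n : ℕ) (k : ℕ) :
    Sup ((i:ℝ) + k / n) (i + (k + 1) / n) (chi (pc i n k) measurableSet_Ioc) := by
  filter_upwards [chi_coe (pc i n k) measurableSet_Ioc] with x hx
  rw [hx, abs_of_nonneg (Set.indicator_nonneg (fun _ _ => zero_le_one) _)]

lemma partB_signs {p q : ℝ≥0∞} (hp : 2 ≤ p) (hpq : p < q) (hq : q ≠ ∞) {C : ℝ}
    {τ σ : A0 →ₗ[ℝ] A0} (D : Dat p q C τ σ) (i : ℕ) (η : ℝ) (hη : 0 < η) :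
    ∃ n : ℕ, 1 ≤ n ∧ ∃ ε : Fin n → Bool, ∀ u, ENNReal.ofReal |pr (st i n fun k => sgn (ε k)) (τ u)| ≤
      ENNReal.ofReal η * NN p u := by
  by_contra! H
  have hp1 : 1 ≤ p := le_trans (by norm_num) hp
  have hq1 : 1 ≤ q := hp1.trans hpq.le
  have ht : p ≠ ∞ := (hpq.trans_le le_top).ne
  have h0 : p ≠ 0 := (zero_lt_one.trans_le hp1).ne'
  have hP : 0 < p.toReal := ENNReal.toReal_pos h0 ht
  have hP2 : 2 ≤ p.toReal := by simpa using ENNReal.toReal_mono ht hp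
  have hC : 0 < C := zero_lt_one.trans_le D.one_le
  have hlt := inv_toReal_lt hp1 hpq
  refine no_growth (a := η) (b := C) (s := 1 / q.toReal - 1 / p.toReal) (t := 0) hη (by linarith) ?_
  intro n hn
  rw [Real.rpow_zero, mul_one]
  have hn' : (0:ℝ) < n := by exact_mod_cast hn
  have e1 : ∀ k : ℕ, (i:ℝ) + (k + 1) / n - (i + k / n) = (n:ℝ)⁻¹ := by
    intro k; field_simp; ring
  have hlt' : ∀ k : ℕ, (i:ℝ) + k / n < i + (k + 1) / n := by
    intro k
    have := e1 k
    have h2 : (0:ℝ) < (n:ℝ)⁻¹ := by positivity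
    linarith
  set F : Fin n → A0 := fun k => chi (pc i n k) measurableSet_Ioc with hF
  -- bounds on coefficient functionals
  have hφ : ∀ (k : Fin n) (f : A0), ENNReal.ofReal |pr (F k) (τ f)| ≤
      ENNReal.ofReal ((n:ℝ) ^ (-(1 - 1 / q.toReal)) * C) * NN p f := by
    intro k f
    refine ((sup_pc i n k).pr_le (by positivity) (hlt' k) hq1 (τ f)).trans ?_
    rw [e1, Real.inv_rpow hn'.le, ← Real.rpow_neg hn'.le, ENNReal.ofReal_mul (by positivity), mul_assoc]
    gcongr
    exact D.tqp f
  have hInt : ∀ (k : Fin n) (f : A0), NN p f < ∞ → Integrable (fun x => F k x * τ f x) m0 := by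
    intro k f hf
    exact (sup_pc i n k).int (by positivity) (hlt' k) hp1 _
      ((D.tpp f).trans_lt (ENNReal.mul_lt_top ENNReal.ofReal_lt_top hf))
  -- normalised functions
  have Hf : ∀ ε : Fin n → Bool, ∃ f : A0, NN p f ≤ 1 ∧ η ≤ ∑ k, sgn (ε k) * pr (F k) (τ f) := by
    intro ε
    obtain ⟨u, hu⟩ := H n hn ε
    have hu1 : NN p u < ∞ := by
      by_contra! h
      rw [top_le_iff.1 h, ENNReal.mul_top (by simpa using hη)] at hu
      exact not_top_lt hu
    have hpr : pr (st i n fun k => sgn (ε k)) (τ u) = ∑ k, sgn (ε k) * pr (F k) (τ u) :=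
      pr_lin_left _ _ _ _ fun k _ => hInt k u hu1
    set S := ∑ k, sgn (ε k) * pr (F k) (τ u) with hS
    rw [hpr] at hu
    have hu0 : NN p u ≠ 0 := by
      intro h
      have : u = 0 := NN_eq_zero h0 u h
      have e : pr (st i n fun k => sgn (ε k)) (τ u) = 0 := by
        unfold pr
        rw [this, map_zero]
        have : ∀ᵐ x ∂m0, (st i n fun k => sgn (ε k)) x * (0 : A0) x = 0 := by
          filter_upwards [AEEqFun.coeFn_zero (α := ℝ) (β := ℝ) (μ := m0)] with x hx
          rw [hx]; simp
        rw [integral_congr_ae this]; simp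
      rw [← hpr, e] at hu
      simp at hu
    have hr0 : 0 < (NN p u).toReal := ENNReal.toReal_pos hu0 hu1.ne
    rw [← ENNReal.ofReal_toReal hu1.ne, ← ENNReal.ofReal_mul hη.le,
      ENNReal.ofReal_lt_ofReal_iff_of_nonneg (by positivity)] at hu
    set ρ := (NN p u).toReal with hρ
    have hscale : ∀ c : ℝ, ∑ k, sgn (ε k) * pr (F k) (τ (c • u)) = c * S := by
      intro c
      rw [hS, Finset.mul_sum]
      refine Finset.sum_congr rfl fun k _ => ?_
      have := pr_lin_right (Finset.univ : Finset Unit) (fun _ => c) (F k) (fun _ => τ u)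
        (fun _ _ => hInt k u hu1)
      simp only [Finset.univ_unique, Finset.sum_singleton] at this
      rw [map_smul, this]
      ring
    refine ⟨(SignType.sign S / ρ : ℝ) • u, ?_, ?_⟩
    · rw [NN_smul, ← ENNReal.ofReal_toReal hu1.ne, Real.enorm_eq_ofReal_abs,
        ← ENNReal.ofReal_mul (abs_nonneg _), ENNReal.ofReal_le_one, abs_div, abs_of_pos hr0,
        div_mul_cancel₀ _ hr0.ne']
      rcases (SignType.sign S) with _ | _ | _ <;> simp
    · rw [hscale, div_mul_eq_mul_div, sign_mul_self, le_div_iff₀ hr0]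
      exact hu.le
  choose f hf1 hf2 using Hf
  have hft : ∀ ε, NN p (f ε) < ∞ := fun ε => (hf1 ε).trans_lt one_lt_top
  set W : Fin n → A0 := fun k => ∑ ε : Fin n → Bool, sgn (ε k) • f ε with hW
  -- averaging
  have havg : 2 ^ n * η ≤ ∑ k, |pr (F k) (τ (W k))| := by
    have e2 : ∀ k, pr (F k) (τ (W k)) = ∑ ε : Fin n → Bool, sgn (ε k) * pr (F k) (τ (f ε)) := by
      intro k
      rw [hW]
      dsimp only
      simp only [map_sum, map_smul]
      exact pr_lin_right _ _ _ _ fun ε _ => hInt k _ (hft ε)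
    calc 2 ^ n * η = ∑ ε : Fin n → Bool, η := by simp
      _ ≤ ∑ ε : Fin n → Bool, ∑ k, sgn (ε k) * pr (F k) (τ (f ε)) := Finset.sum_le_sum fun ε _ => hf2 ε
      _ = ∑ k, pr (F k) (τ (W k)) := by
          rw [Finset.sum_comm]
          simp_rw [e2]
      _ ≤ _ := Finset.sum_le_sum fun k _ => le_abs_self _
  have hWp : ∑ k, NN p (W k) ^ p.toReal ≤ ENNReal.ofReal (((2:ℝ) ^ n) ^ p.toReal) := by
    have hm : ∀ ε, Measurable (f ε) := fun ε => (f ε).measurable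
    have hcoe : ∀ k, NN p (W k) ^ p.toReal =
        ∫⁻ x, ENNReal.ofReal (|∑ ε : Fin n → Bool, sgn (ε k) * f ε x| ^ p.toReal) ∂m0 := by
      intro k
      exact NN_rpow_lin h0 ht (fun ε : Fin n → Bool => sgn (ε k)) f
    simp_rw [hcoe]
    rw [← lintegral_finsetSum _ (fun k _ => by fun_prop)]
    calc _ ≤ ∫⁻ x, ENNReal.ofReal (((2:ℝ) ^ n) ^ (p.toReal - 1)) *
          ∑ ε : Fin n → Bool, ENNReal.ofReal (|f ε x| ^ p.toReal) ∂m0 := by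
          refine lintegral_mono fun x => ?_
          rw [← ENNReal.ofReal_sum_of_nonneg (fun _ _ => by positivity),
            ← ENNReal.ofReal_sum_of_nonneg (fun _ _ => by positivity),
            ← ENNReal.ofReal_mul (by positivity)]
          apply ENNReal.ofReal_le_ofReal
          have := bessel_rpow (fun ε : Fin n → Bool => f ε x) p.toReal hP2
          rwa [Fintype.card_fin] at this
      _ = ENNReal.ofReal (((2:ℝ) ^ n) ^ (p.toReal - 1)) * ∑ ε : Fin n → Bool, NN p (f ε) ^ p.toReal := by
          rw [lintegral_const_mul' _ _ ENNReal.ofReal_ne_top, lintegral_finsetSum]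
          · simp_rw [NN_rpow h0 ht]
          · intro ε _
            fun_prop
      _ ≤ ENNReal.ofReal (((2:ℝ) ^ n) ^ (p.toReal - 1)) * ∑ ε : Fin n → Bool, 1 := by
          gcongr with ε
          exact ENNReal.rpow_le_one (hf1 ε) hP.le
      _ = _ := by
          have : (∑ ε : Fin n → Bool, (1:ℝ≥0∞)) = ENNReal.ofReal (2 ^ n) := by
            simp [ENNReal.ofReal_pow]
          rw [this, ← ENNReal.ofReal_mul (by positivity)]
          congr 1
          nth_rw 2 [← Real.rpow_one ((2:ℝ) ^ n)]
          rw [← Real.rpow_add (by positivity)]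
          congr 1
          ring
  have hWs : ∑ k, NN p (W k) ≤ ENNReal.ofReal ((n:ℝ) ^ (1 - 1 / p.toReal) * 2 ^ n) := by
    have h1 := ENNReal.rpow_sum_le_const_mul_sum_rpow (Finset.univ : Finset (Fin n))
      (fun k => NN p (W k)) (p := p.toReal) (by linarith)
    rw [← ENNReal.rpow_le_rpow_iff hP]
    refine h1.trans ((mul_le_mul_right hWp _).trans (le_of_eq ?_))
    rw [Finset.card_univ, Fintype.card_fin, ← ENNReal.ofReal_natCast,
      ENNReal.ofReal_rpow_of_pos hn', ← ENNReal.ofReal_mul (by positivity),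
      ENNReal.ofReal_rpow_of_nonneg (by positivity) hP.le, Real.mul_rpow (by positivity) (by positivity),
      ← Real.rpow_mul hn'.le]
    congr 3
    field_simp
  have hfin : ENNReal.ofReal (2 ^ n * η) ≤ ENNReal.ofReal ((n:ℝ) ^ (-(1 - 1 / q.toReal)) * C *
      ((n:ℝ) ^ (1 - 1 / p.toReal) * 2 ^ n)) := by
    refine (ENNReal.ofReal_le_ofReal havg).trans ?_
    rw [ENNReal.ofReal_sum_of_nonneg (fun _ _ => abs_nonneg _), ENNReal.ofReal_mul (by positivity)]
    refine (Finset.sum_le_sum fun k _ => hφ k (W k)).trans ?_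
    rw [← Finset.mul_sum]
    gcongr
  rw [ENNReal.ofReal_le_ofReal_iff (by positivity)] at hfin
  have e3 : (n:ℝ) ^ (1 / q.toReal - 1 / p.toReal) =
      (n:ℝ) ^ (-(1 - 1 / q.toReal)) * (n:ℝ) ^ (1 - 1 / p.toReal) := by
    rw [← Real.rpow_add hn']
    congr 1
    ring
  rw [e3]
  refine le_of_mul_le_mul_left (hfin.trans (le_of_eq ?_)) (show (0:ℝ) < 2 ^ n by positivity)
  ring

lemma exists_far {q : ℝ≥0∞} (h0 : q ≠ 0) (ht : q ≠ ∞) (N : ℕ) (f : A0) (hf : NN q f < ∞) (η : ℝ)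
    (hη : 0 < η) :
    ∃ N' : ℕ, N ≤ N' ∧ NN q (cut (Set.Ioi (N':ℝ)) measurableSet_Ioi f) ≤ ENNReal.ofReal η := by
  have hp : 0 < q.toReal := ENNReal.toReal_pos h0 ht
  set ν := m0.withDensity (fun x => ENNReal.ofReal (|f x| ^ q.toReal)) with hν
  have hmono : Antitone fun n : ℕ => Set.Ioi (n:ℝ) := by
    intro a b hab
    exact Set.Ioi_subset_Ioi (by exact_mod_cast hab)
  have hval : ∀ n : ℕ, ν (Set.Ioi (n:ℝ)) =
      NN q (cut (Set.Ioi (n:ℝ)) measurableSet_Ioi f) ^ q.toReal := by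
    intro n
    rw [hν, withDensity_apply _ measurableSet_Ioi, ← NN_cut_rpow h0 ht _ measurableSet_Ioi]
  have hfin : ν (Set.Ioi ((0:ℕ):ℝ)) ≠ ∞ := by
    rw [hval]
    exact ENNReal.rpow_ne_top_of_nonneg hp.le ((NN_cut_le _ _ _ _).trans_lt hf).ne
  have h1 := tendsto_measure_iInter_atTop (μ := ν)
    (s := fun n : ℕ => Set.Ioi (n:ℝ)) (fun n => measurableSet_Ioi.nullMeasurableSet) hmono ⟨0, hfin⟩
  have h2 : ⋂ n : ℕ, Set.Ioi (n:ℝ) = ∅ := by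
    ext x
    simp only [Set.mem_iInter, Set.mem_Ioi, Set.mem_empty_iff_false, iff_false, not_forall, not_lt]
    exact exists_nat_ge x
  rw [h2, measure_empty] at h1
  have h3 : (0:ℝ≥0∞) < ENNReal.ofReal η ^ q.toReal :=
    ENNReal.rpow_pos (ENNReal.ofReal_pos.2 hη) ENNReal.ofReal_ne_top
  obtain ⟨N', h4, h5⟩ := ((h1.eventually_lt_const h3).and (Filter.eventually_ge_atTop N)).exists
  refine ⟨N', h5, ?_⟩
  simp only [Function.comp] at h4
  rw [hval] at h4
  exact (ENNReal.rpow_le_rpow_iff hp).1 h4.le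

lemma Bd.sup {i : ℕ} {G : A0} (h : Bd i G) : Sup (i:ℝ) (i + 1) G := h

lemma pr_st (i n : ℕ) (hn : 1 ≤ n) (ε : Fin n → Bool) :
    pr (st i n fun k => sgn (ε k)) (st i n fun k => sgn (ε k)) = 1 := by
  unfold pr
  have : ∀ᵐ x ∂m0, (st i n fun k => sgn (ε k)) x * (st i n fun k => sgn (ε k)) x =
      (II i).indicator (fun _ => (1:ℝ)) x := by
    filter_upwards [st_coe i n hn fun k => sgn (ε k)] with x hx
    by_cases h : x ∈ II i
    · rw [Set.indicator_of_mem h]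
      rw [← pc_union i n hn] at h
      obtain ⟨k, hk⟩ := Set.mem_iUnion.1 h
      rw [hx.1 k hk, sgn_mul_self]
    · rw [hx.2 h, Set.indicator_of_notMem h, mul_zero]
  rw [integral_congr_ae this, integral_indicator measurableSet_Ioc, setIntegral_const,
    Measure.real, m0_Ioc _ _ (by positivity)]
  simp

lemma partB_step {p q : ℝ≥0∞} (hp : 2 ≤ p) (hpq : p < q) (hq : q ≠ ∞) {C : ℝ}
    {τ σ : A0 →ₗ[ℝ] A0} (D : Dat p q C τ σ) (i N : ℕ) :
    ∃ G v : A0, ∃ N' : ℕ, Bd i G ∧ N ≤ N' ∧ (∀ᵐ x ∂m0, x ∉ Set.Ioc (N:ℝ) N' → v x = 0) ∧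
      NN q v ≤ ENNReal.ofReal C ∧ 1 / 4 ≤ pr G (τ v) := by
  have hp1 : 1 ≤ p := le_trans (by norm_num) hp
  have hq1 : 1 ≤ q := hp1.trans hpq.le
  have h0 : p ≠ 0 := (zero_lt_one.trans_le hp1).ne'
  have hq0 : q ≠ 0 := (zero_lt_one.trans_le hq1).ne'
  have hC : 0 < C := zero_lt_one.trans_le D.one_le
  set R := (N:ℝ) ^ (1 / p.toReal - 1 / q.toReal) with hR
  have hR0 : 0 ≤ R := by positivity
  set η : ℝ := 1 / (4 * C * (1 + R)) with hηdef
  have hη : 0 < η := by positivity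
  obtain ⟨n, hn, ε, hε⟩ := partB_signs hp hpq hq D i η hη
  set G := st i n fun k => sgn (ε k) with hG
  have hBd : Bd i G := st_Bd i n hn _ fun k => (sgn_abs _).le
  have hi1 : (i:ℝ) < i + 1 := by linarith
  have hGp := hBd.NN_le h0
  have hGq := hBd.NN_le hq0
  obtain ⟨u, v, huv, hle⟩ := D.s G (hGp.trans_lt one_lt_top) (hGq.trans_lt one_lt_top)
  have hle' : NN p u + NN q v ≤ ENNReal.ofReal C :=
    hle.trans ((mul_le_mul_right (max_le hGp hGq) _).trans (by rw [mul_one]))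
  have hu : NN p u ≤ ENNReal.ofReal C := le_self_add.trans hle'
  have hv : NN q v ≤ ENNReal.ofReal C := le_add_self.trans hle'
  set hd := cut (Set.Ioi (N:ℝ))ᶜ measurableSet_Ioi.compl v with hhd
  set w := cut (Set.Ioi (N:ℝ)) measurableSet_Ioi v with hw
  have hwq : NN q w ≤ ENNReal.ofReal C := (NN_cut_le _ _ _ _).trans hv
  obtain ⟨N', hN', hfar⟩ := exists_far hq0 hq N w (hwq.trans_lt ENNReal.ofReal_lt_top) (1 / (4 * C))
    (by positivity)
  set far := cut (Set.Ioi (N':ℝ)) measurableSet_Ioi w with hfardef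
  set mid := cut (Set.Ioi (N':ℝ))ᶜ measurableSet_Ioi.compl w with hmid
  have hmidq : NN q mid ≤ ENNReal.ofReal C := (NN_cut_le _ _ _ _).trans hwq
  have hhdp : NN p hd ≤ ENNReal.ofReal (R * C) := by
    refine (head_le hp1 hpq N v).trans ?_
    rw [ENNReal.ofReal_mul hR0]
    gcongr
  refine ⟨G, mid, N', hBd, hN', ?_, hmidq, ?_⟩
  · filter_upwards [cut_coe (Set.Ioi (N':ℝ))ᶜ measurableSet_Ioi.compl w,
      cut_coe (Set.Ioi (N:ℝ)) measurableSet_Ioi v] with x h1 h2 hx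
    rw [hmid, h1]
    by_cases h3 : x ∈ (Set.Ioi (N':ℝ))ᶜ
    · rw [Set.indicator_of_mem h3, hw, h2, Set.indicator_of_notMem]
      intro h4
      exact hx ⟨h4, by simpa using h3⟩
    · rw [Set.indicator_of_notMem h3]
  · have hintp : ∀ f, NN p f < ∞ → Integrable (fun x => G x * τ f x) m0 := fun f hf =>
      hBd.sup.int (by positivity) hi1 hp1 _
        ((D.tpp f).trans_lt (ENNReal.mul_lt_top ENNReal.ofReal_lt_top hf))
    have hintq : ∀ f, NN q f < ∞ → Integrable (fun x => G x * τ f x) m0 := fun f hf =>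
      hBd.sup.int (by positivity) hi1 hp1 _
        ((D.tpq f).trans_lt (ENNReal.mul_lt_top ENNReal.ofReal_lt_top hf))
    have i1 := hintp u (hu.trans_lt ENNReal.ofReal_lt_top)
    have i2 := hintp hd (hhdp.trans_lt ENNReal.ofReal_lt_top)
    have i3 := hintq far (hfar.trans_lt ENNReal.ofReal_lt_top)
    have i4 := hintq mid (hmidq.trans_lt ENNReal.ofReal_lt_top)
    have iw := hintq w (hwq.trans_lt ENNReal.ofReal_lt_top)
    have iv := hintq v (hv.trans_lt ENNReal.ofReal_lt_top)
    have e1 : pr G (τ w) = pr G (τ far) + pr G (τ mid) := by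
      rw [← pr_add i3 i4, ← map_add, ← cut_add_compl]
    have e2 : pr G (τ v) = pr G (τ w) + pr G (τ hd) := by
      rw [← pr_add iw i2, ← map_add, ← cut_add_compl]
    have e3 : (1:ℝ) = pr G (τ u) + pr G (τ v) := by
      rw [← pr_add i1 iv, ← map_add, ← huv, D.τσ G (hGp.trans_lt one_lt_top) (hGq.trans_lt one_lt_top)]
      exact (pr_st i n hn ε).symm
    have b1 : |pr G (τ u)| ≤ η * C := by
      have := (hε u).trans (mul_le_mul_right hu _)
      rwa [← ENNReal.ofReal_mul hη.le, ENNReal.ofReal_le_ofReal_iff (by positivity)] at this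
    have b2 : |pr G (τ hd)| ≤ η * (R * C) := by
      have := (hε hd).trans (mul_le_mul_right hhdp _)
      rwa [← ENNReal.ofReal_mul hη.le, ENNReal.ofReal_le_ofReal_iff (by positivity)] at this
    have b3 : |pr G (τ far)| ≤ 1 / 4 := by
      have := hBd.sup.pr_le (by positivity) hi1 hq1 (τ far)
      simp only [add_sub_cancel_left, Real.one_rpow, ENNReal.ofReal_one, one_mul] at this
      have := this.trans ((D.tqq far).trans (mul_le_mul_right hfar _))
      rw [← ENNReal.ofReal_mul hC.le, ENNReal.ofReal_le_ofReal_iff (by positivity)] at this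
      refine this.trans (le_of_eq ?_)
      field_simp
    have b4 : η * C + η * (R * C) = 1 / 4 := by
      rw [hηdef]; field_simp
    have := le_abs_self (pr G (τ u))
    have := le_abs_self (pr G (τ hd))
    have := le_abs_self (pr G (τ far))
    linarith

lemma abs_sum_rpow_le {ι : Type} [Fintype ι] (y : ι → ℝ) (Q : ℝ) (hQ : 0 < Q)
    (h : ∀ i j, i ≠ j → y i = 0 ∨ y j = 0) : |∑ i, y i| ^ Q ≤ ∑ i, |y i| ^ Q := by
  by_cases hz : ∃ i, y i ≠ 0
  · obtain ⟨i, hi⟩ := hz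
    rw [Fintype.sum_eq_single i (fun j hj => (h j i hj).resolve_right hi)]
    exact Finset.single_le_sum (f := fun i => |y i| ^ Q) (fun _ _ => by positivity) (Finset.mem_univ i)
  · push Not at hz
    simp [hz, Real.zero_rpow hQ.ne']

lemma partB {p q : ℝ≥0∞} (hp : 2 ≤ p) (hpq : p < q) (hq : q ≠ ∞) {C : ℝ}
    {τ σ : A0 →ₗ[ℝ] A0} (D : Dat p q C τ σ) : False := by
  have hp1 : 1 ≤ p := le_trans (by norm_num) hp
  have hq1 : 1 ≤ q := hp1.trans hpq.le
  have h0 : p ≠ 0 := (zero_lt_one.trans_le hp1).ne'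
  have hq0 : q ≠ 0 := (zero_lt_one.trans_le hq1).ne'
  have hQ : 0 < q.toReal := ENNReal.toReal_pos hq0 hq
  have hC : 0 < C := zero_lt_one.trans_le D.one_le
  have hlt := inv_toReal_lt hp1 hpq
  choose g v n hg1 hg2 hg3 hg4 hg5 using partB_step hp hpq hq D
  let M : ℕ → ℕ := fun i => Nat.rec (motive := fun _ => ℕ) 0 (fun i N => n i N) i
  have hM : ∀ i, M (i+1) = n i (M i) := fun i => rfl
  have hMm : Monotone (fun i : ℕ => ((M i : ℕ) : ℝ)) := by
    apply monotone_nat_of_le_succ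
    intro i
    rw [hM]
    exact_mod_cast hg2 i (M i)
  have hdis := hMm.pairwise_disjoint_on_Ioc_succ
  let G : ℕ → A0 := fun i => g i (M i)
  let V : ℕ → A0 := fun i => v i (M i)
  have hG : ∀ i, Bd i (G i) := fun i => hg1 i (M i)
  have hV3 : ∀ i, ∀ᵐ x ∂m0, x ∉ Set.Ioc (M i:ℝ) (M (i+1)) → V i x = 0 := fun i => hg3 i (M i)
  have hV4 : ∀ i, NN q (V i) ≤ ENNReal.ofReal C := fun i => hg4 i (M i)
  have hV5 : ∀ i, 1 / 4 ≤ pr (G i) (τ (V i)) := fun i => hg5 i (M i)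
  have hsup : ∀ᵐ x ∂m0, ∀ i j, i ≠ j → V i x = 0 ∨ V j x = 0 := by
    filter_upwards [ae_all_iff.2 hV3] with x hx i j hij
    by_contra! hc
    have h1 : x ∈ Set.Ioc (M i:ℝ) (M (i+1)) := by
      by_contra h; exact hc.1 (hx i h)
    have h2 : x ∈ Set.Ioc (M j:ℝ) (M (j+1)) := by
      by_contra h; exact hc.2 (hx j h)
    exact Set.disjoint_left.1 (hdis hij) h1 h2
  refine no_growth (a := 1 / 4) (b := C * C) (s := 1 - 1 / p.toReal + 1 / q.toReal) (t := 1)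
    (by norm_num) (by linarith) fun m hm => ?_
  have hm0 : (0:ℝ) < m := by exact_mod_cast hm
  rw [Real.rpow_one]
  have hVsum : ∀ ε : Fin m → Bool, NN q (∑ j : Fin m, sgn (ε j) • V j) ≤
      ENNReal.ofReal ((m:ℝ) ^ (1 / q.toReal) * C) := by
    intro ε
    have hmeas : ∀ k, Measurable (V k) := fun k => (V k).measurable
    rw [← ENNReal.rpow_le_rpow_iff hQ, NN_rpow_lin hq0 hq (fun j : Fin m => sgn (ε j)) (fun j => V j)]
    calc _ ≤ ∫⁻ x, ∑ j : Fin m, ENNReal.ofReal (|V j x| ^ q.toReal) ∂m0 := by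
          refine lintegral_mono_ae ?_
          filter_upwards [hsup] with x hx
          rw [← ENNReal.ofReal_sum_of_nonneg (fun _ _ => by positivity)]
          apply ENNReal.ofReal_le_ofReal
          refine (abs_sum_rpow_le _ _ hQ ?_).trans (le_of_eq ?_)
          · intro a b hab
            rcases hx a b (fun h => hab (Fin.ext h)) with h | h
            · left; rw [h, mul_zero]
            · right; rw [h, mul_zero]
          · refine Finset.sum_congr rfl fun j _ => ?_
            rw [abs_mul, sgn_abs, one_mul]
      _ = ∑ j : Fin m, NN q (V j) ^ q.toReal := by
          rw [lintegral_finsetSum]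
          · simp_rw [NN_rpow hq0 hq]
          · intro j _
            fun_prop
      _ ≤ ∑ j : Fin m, ENNReal.ofReal C ^ q.toReal := by
          gcongr with j
          exact hV4 j
      _ = _ := by
          rw [Finset.sum_const, Finset.card_univ, Fintype.card_fin, nsmul_eq_mul,
            ENNReal.ofReal_mul (by positivity), ENNReal.mul_rpow_of_nonneg _ _ hQ.le,
            ENNReal.ofReal_rpow_of_nonneg (x := (m:ℝ) ^ (1 / q.toReal)) (by positivity) hQ.le, ← Real.rpow_mul hm0.le,
            one_div_mul_cancel hQ.ne', Real.rpow_one, ENNReal.ofReal_natCast]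
  have hGsup : ∀ ε : Fin m → Bool, Sup 0 m (∑ j : Fin m, sgn (ε j) • G j) := by
    intro ε
    filter_upwards [Bd.sum hG ε, coeFn_lin Finset.univ (fun i : Fin m => sgn (ε i))
      (fun i : Fin m => G i)] with x h1 h2
    rwa [h2]
  have hup : ∀ ε : Fin m → Bool, pr (∑ j : Fin m, sgn (ε j) • G j) (∑ j : Fin m, sgn (ε j) • τ (V j)) ≤
      (m:ℝ) ^ (1 - 1 / p.toReal) * (C * ((m:ℝ) ^ (1 / q.toReal) * C)) := by
    intro ε
    have e : ∑ j : Fin m, sgn (ε j) • τ (V j) = τ (∑ j : Fin m, sgn (ε j) • V j) := by simp [map_sum]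
    refine (le_abs_self _).trans ?_
    rw [← ENNReal.ofReal_le_ofReal_iff (by positivity), e]
    refine ((hGsup ε).pr_le le_rfl hm0 hp1 _).trans ?_
    rw [sub_zero, ENNReal.ofReal_mul (p := (m:ℝ) ^ (1 - 1 / p.toReal)) (by positivity),
      ENNReal.ofReal_mul (p := C) hC.le]
    gcongr
    exact (D.tpq _).trans (mul_le_mul_right (hVsum ε) _)
  have hInt : ∀ i j : ℕ, Integrable (fun x => G i x * τ (V j) x) m0 := fun i j =>
    (hG i).sup.int (by positivity) (by linarith) hp1 _
      ((D.tpq _).trans_lt (ENNReal.mul_lt_top ENNReal.ofReal_lt_top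
        ((hV4 j).trans_lt ENNReal.ofReal_lt_top)))
  have hexp : ∀ ε : Fin m → Bool, pr (∑ j : Fin m, sgn (ε j) • G j) (∑ j : Fin m, sgn (ε j) • τ (V j)) =
      ∑ i : Fin m, ∑ j : Fin m, (sgn (ε i) * sgn (ε j)) * pr (G i) (τ (V j)) := by
    intro ε
    rw [pr_lin_right]
    · rw [Finset.sum_comm]
      refine Finset.sum_congr rfl fun j _ => ?_
      have e := pr_lin_left Finset.univ (fun i : Fin m => sgn (ε i)) (fun i : Fin m => G i)
        (τ (V j)) (fun i _ => hInt i j)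
      rw [e, Finset.mul_sum]
      exact Finset.sum_congr rfl fun i _ => by ring
    · intro j _
      exact (hGsup ε).int le_rfl hm0 hp1 _
        ((D.tpq _).trans_lt (ENNReal.mul_lt_top ENNReal.ofReal_lt_top
          ((hV4 j).trans_lt ENNReal.ofReal_lt_top)))
  have hlow : (2:ℝ) ^ m * (1 / 4 * m) ≤
      ∑ ε : Fin m → Bool, pr (∑ j : Fin m, sgn (ε j) • G j) (∑ j : Fin m, sgn (ε j) • τ (V j)) := by
    simp_rw [hexp]
    rw [Finset.sum_comm]
    have : ∀ i ∈ (Finset.univ : Finset (Fin m)), (2:ℝ) ^ m * (1 / 4) ≤ ∑ ε : Fin m → Bool, ∑ j : Fin m,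
        (sgn (ε i) * sgn (ε j)) * pr (G i) (τ (V j)) := by
      intro i _
      rw [Finset.sum_comm]
      simp_rw [← Finset.sum_mul, sum_sgn_mul]
      simp only [ite_mul, zero_mul, Finset.sum_ite_eq, Finset.mem_univ, if_true, Fintype.card_fin]
      exact mul_le_mul_of_nonneg_left (hV5 i) (by positivity)
    refine le_trans (le_of_eq ?_) (Finset.sum_le_sum this)
    simp; ring
  have hfin := hlow.trans (Finset.sum_le_sum fun ε _ => hup ε)
  rw [Finset.sum_const, Finset.card_univ] at hfin
  simp only [Fintype.card_pi, Fintype.card_bool, Finset.prod_const, Finset.card_univ,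
    Fintype.card_fin, nsmul_eq_mul, Nat.cast_pow, Nat.cast_ofNat] at hfin
  have := le_of_mul_le_mul_left hfin (by positivity)
  refine this.trans (le_of_eq ?_)
  rw [Real.rpow_add hm0]
  ring

/-! ### Main theorem -/

lemma no_iso {p q : ℝ≥0∞} {C : ℝ} {τ σ} (hp : 1 ≤ p) (hpq : p < q) (D : Dat p q C τ σ) : False := by
  by_cases hq : q = ∞
  · subst hq
    exact partC hp hpq D
  · rcases lt_or_ge p 2 with h | h
    · exact partA hp hpq h hq D
    · exact partB h hpq hq D

/-- For all `1 ≤ p, q ≤ ∞`, the Banach spaces `L_p + L_q` and `L_p ∩ L_q`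
on `(0, ∞)` are isomorphic if and only if `p = q`. -/
theorem sum_isomorphic_inter_iff_eq (p q : ℝ≥0∞) (hp : 1 ≤ p) (hq : 1 ≤ q) :
    SumInterIsomorphic p q ↔ p = q := by
  constructor
  · intro h
    obtain ⟨C, τ, σ, D⟩ := exists_Dat p q hp h
    by_contra hne
    rcases lt_or_gt_of_ne hne with h1 | h1
    · exact no_iso hp h1 D
    · exact no_iso hq h1 D.symm
  · rintro rfl
    exact iso_self p hp
end
end

section
/- The Banach spaces L_2 + L_∞ on (0, ∞) and L_2 ∩ L_∞ on (0, ∞) are not isomorphic. -/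
open MeasureTheory ENNReal

noncomputable section

def sg (b : Bool) : ℝ := if b then 1 else -1

theorem sum_cons_bool (m : ℕ) (g : (Fin (m+1) → Bool) → ℝ) :
    ∑ e, g e = ∑ d : Fin m → Bool, (g (Fin.cons true d) + g (Fin.cons false d)) := by
  rw [← (Fin.consEquiv (fun _ : Fin (m+1) => Bool)).sum_comp, Fintype.sum_prod_type]
  simp [Fin.consEquiv, Finset.sum_add_distrib]

theorem rad_first (m : ℕ) (a : Fin m → ℝ) :
    ∑ e : Fin m → Bool, ∑ k, sg (e k) * a k = 0 := by
  induction m with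
  | zero => simp
  | succ m ih =>
    rw [sum_cons_bool]
    simp only [Fin.sum_univ_succ, Fin.cons_zero, Fin.cons_succ]
    have := ih (fun k => a k.succ)
    calc _ = ∑ d : Fin m → Bool, 2 * ∑ k, sg (d k) * a k.succ := by
          refine Finset.sum_congr rfl fun d _ => ?_
          simp [sg]; ring
      _ = 0 := by rw [← Finset.mul_sum, this, mul_zero]

theorem rad_bilin (m : ℕ) (a b : Fin m → ℝ) :
    ∑ e : Fin m → Bool, (∑ k, sg (e k) * a k) * (∑ k, sg (e k) * b k)
      = 2 ^ m * ∑ k, a k * b k := by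
  induction m with
  | zero => simp
  | succ m ih =>
    rw [sum_cons_bool]
    simp only [Fin.sum_univ_succ, Fin.cons_zero, Fin.cons_succ]
    have := ih (fun k => a k.succ) (fun k => b k.succ)
    calc _ = ∑ d : Fin m → Bool, (2 * (a 0 * b 0) +
            2 * ((∑ k, sg (d k) * a k.succ) * (∑ k, sg (d k) * b k.succ))) := by
          refine Finset.sum_congr rfl fun d _ => ?_
          simp [sg]; ring
      _ = _ := by
          rw [Finset.sum_add_distrib, ← Finset.mul_sum Finset.univ (fun d : Fin m → Bool => (∑ k, sg (d k) * a k.succ) * (∑ k, sg (d k) * b k.succ)), this]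
          simp; ring

theorem rad_fourth (m : ℕ) (a : Fin m → ℝ) :
    ∑ e : Fin m → Bool, (∑ k, sg (e k) * a k) ^ 4 ≤ 2 ^ m * (3 * (∑ k, a k ^ 2) ^ 2) := by
  induction m with
  | zero => simp
  | succ m ih =>
    rw [sum_cons_bool]
    simp only [Fin.sum_univ_succ, Fin.cons_zero, Fin.cons_succ]
    have h4 := ih (fun k => a k.succ)
    have h2 := rad_bilin m (fun k => a k.succ) (fun k => a k.succ)
    calc _ = ∑ d : Fin m → Bool, (2 * a 0 ^ 4 + 12 * a 0 ^ 2 *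
            ((∑ k, sg (d k) * a k.succ) * (∑ k, sg (d k) * a k.succ)) +
            2 * (∑ k, sg (d k) * a k.succ) ^ 4) := by
          refine Finset.sum_congr rfl fun d _ => ?_
          simp [sg]; ring
      _ = 2 ^ m * (2 * a 0 ^ 4) + 12 * a 0 ^ 2 * (2 ^ m * ∑ k : Fin m, a k.succ * a k.succ)
          + 2 * ∑ d : Fin m → Bool, (∑ k, sg (d k) * a k.succ) ^ 4 := by
          rw [Finset.sum_add_distrib, Finset.sum_add_distrib, ← h2, Finset.mul_sum, Finset.mul_sum]
          simp
      _ ≤ _ := by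
          have hs : ∑ k : Fin m, a k.succ * a k.succ = ∑ k : Fin m, a k.succ ^ 2 := by
            simp [sq]
          rw [hs]
          set s := ∑ k : Fin m, a k.succ ^ 2
          have : (0:ℝ) ≤ 2 ^ m * (4 * a 0 ^ 4) := by positivity
          have e2 : (2:ℝ) ^ (m+1) = 2 * 2 ^ m := by ring
          rw [e2]
          nlinarith

/-- pointwise truncation lemma -/
theorem trunc_bound (F b : ℝ) (hb : 0 ≤ b) :
    4 * b * |F - max (-b) (min b F)| ≤ F ^ 2 := by
  rcases le_total b F with h | h
  · rw [min_eq_left h, max_eq_right (by linarith), abs_of_nonneg (by linarith)]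
    nlinarith [sq_nonneg (F - 2 * b)]
  · rw [min_eq_right h]
    rcases le_total (-b) F with h' | h'
    · rw [max_eq_right h']; simp; positivity
    · rw [max_eq_left h', abs_of_nonpos (by linarith)]
      nlinarith [sq_nonneg (F + 2 * b)]

theorem bessel_pt (m : ℕ) (R : (Fin m → Bool) → ℝ) :
    ∑ k, ((2 ^ m : ℝ)⁻¹ * ∑ e, sg (e k) * R e) ^ 2 ≤ (2 ^ m : ℝ)⁻¹ * ∑ e, R e ^ 2 := by
  set h : Fin m → ℝ := fun k => (2 ^ m : ℝ)⁻¹ * ∑ e, sg (e k) * R e with hh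
  have h2 := rad_bilin m h h
  have h1 : ∑ e : Fin m → Bool, R e * ∑ k, sg (e k) * h k = 2 ^ m * ∑ k, h k ^ 2 := by
    simp_rw [Finset.mul_sum]
    rw [Finset.sum_comm]
    refine Finset.sum_congr rfl fun k _ => ?_
    have : ∑ e, sg (e k) * R e = 2 ^ m * h k := by simp [hh]
    calc _ = (∑ e, sg (e k) * R e) * h k := by
          rw [Finset.sum_mul]; refine Finset.sum_congr rfl fun e _ => by ring
      _ = _ := by rw [this]; ring
  have h0 : 0 ≤ ∑ e : Fin m → Bool, (R e - ∑ k, sg (e k) * h k) ^ 2 :=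
    Finset.sum_nonneg fun _ _ => sq_nonneg _
  have : ∑ e : Fin m → Bool, (R e - ∑ k, sg (e k) * h k) ^ 2
      = ∑ e, R e ^ 2 - 2 * ∑ e : Fin m → Bool, R e * ∑ k, sg (e k) * h k
        + ∑ e : Fin m → Bool, (∑ k, sg (e k) * h k) * (∑ k, sg (e k) * h k) := by
    rw [Finset.mul_sum, ← Finset.sum_sub_distrib, ← Finset.sum_add_distrib]
    refine Finset.sum_congr rfl fun e _ => by ring
  rw [this, h1, h2] at h0
  have h3 : ∑ k, h k * h k = ∑ k, h k ^ 2 := by simp [sq]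
  rw [h3] at h0
  rw [← div_eq_inv_mul, le_div_iff₀ (by positivity)]
  linarith

/-- `h_k` estimate: with truncation level `2 * b`. -/
theorem remainder_pt (m : ℕ) (a : Fin m → ℝ) (b : ℝ) (hb : 0 ≤ b) (hab : ∑ k, a k ^ 2 ≤ b ^ 2) :
    ∑ k, ((2 ^ m : ℝ)⁻¹ * ∑ e : Fin m → Bool, sg (e k) *
      ((∑ j, sg (e j) * a j) - max (-(2*b)) (min (2*b) (∑ j, sg (e j) * a j)))) ^ 2
      ≤ (b / 2) ^ 2 := by
  refine (bessel_pt m _).trans ?_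
  rcases hb.eq_or_lt with rfl | hb'
  · have ha : ∀ k, a k = 0 := by
      intro k
      have := Finset.single_le_sum (f := fun k => a k ^ 2) (fun i _ => sq_nonneg _) (Finset.mem_univ k)
      have h2 : a k ^ 2 ≤ 0 := by simpa using this.trans hab
      exact pow_eq_zero_iff (two_ne_zero) |>.1 (le_antisymm h2 (sq_nonneg _))
    simp [ha]
  · have key : ∀ e : Fin m → Bool, ((∑ j, sg (e j) * a j) -
        max (-(2*b)) (min (2*b) (∑ j, sg (e j) * a j))) ^ 2 ≤ (∑ j, sg (e j) * a j) ^ 4 / (64 * b ^ 2) := by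
      intro e
      set F := ∑ j, sg (e j) * a j
      have := trunc_bound F (2*b) (by positivity)
      rw [le_div_iff₀ (by positivity), ← sq_abs]
      have h := pow_le_pow_left₀ (by positivity) this 2
      calc _ = (4 * (2 * b) * |F - max (-(2 * b)) (min (2 * b) F)|) ^ 2 := by ring
        _ ≤ _ := h
        _ = _ := by ring
    calc _ ≤ (2 ^ m : ℝ)⁻¹ * ∑ e : Fin m → Bool, (∑ j, sg (e j) * a j) ^ 4 / (64 * b ^ 2) := by
          gcongr with e; exact key e
      _ = (2 ^ m : ℝ)⁻¹ * ((∑ e : Fin m → Bool, (∑ j, sg (e j) * a j) ^ 4) / (64 * b ^ 2)) := by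
          rw [Finset.sum_div]
      _ ≤ (2 ^ m : ℝ)⁻¹ * ((2 ^ m * (3 * (b ^ 2) ^ 2)) / (64 * b ^ 2)) := by
          gcongr
          refine (rad_fourth m a).trans ?_
          have : 0 ≤ ∑ k, a k ^ 2 := Finset.sum_nonneg fun _ _ => sq_nonneg _
          gcongr
      _ = 3 / 64 * b ^ 2 := by field_simp
      _ ≤ _ := by nlinarith

/-- measurable functions dominated by a multiple of `w` -/
def domSpace {α : Type*} [MeasurableSpace α] (w : α → ℝ) : Submodule ℝ (α → ℝ) where
  carrier := {g | Measurable g ∧ ∃ c, ∀ x, |g x| ≤ c * w x}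
  zero_mem' := ⟨measurable_const, 0, by simp⟩
  add_mem' := by
    rintro f g ⟨hf, c, hc⟩ ⟨hg, d, hd⟩
    refine ⟨hf.add hg, c + d, fun x => ?_⟩
    have := abs_add_le (f x) (g x)
    have := hc x
    have := hd x
    simp only [Pi.add_apply]
    linarith
  smul_mem' := by
    rintro r f ⟨hf, c, hc⟩
    refine ⟨hf.const_smul r, |r| * c, fun x => ?_⟩
    simp only [Pi.smul_apply, smul_eq_mul, abs_mul, mul_assoc]
    exact mul_le_mul_of_nonneg_left (hc x) (abs_nonneg _)

def GP {α : Type*} [MeasurableSpace α] (w : α → ℝ) (m : ℕ)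
    (ψ : Fin m → domSpace w →ₗ[ℝ] ℝ) (K : ℝ) : Prop := ∀ t : ℝ, 0 ≤ t → ∀ f : Fin m → domSpace w,
  (∀ x, ∑ k, (f k : α → ℝ) x ^ 2 ≤ (t * w x) ^ 2) → ∑ k, ψ k (f k) ≤ K * t

theorem GP_base {α : Type*} [MeasurableSpace α] (w : α → ℝ) (hw0 : ∀ x, 0 ≤ w x)
    (m : ℕ) (ψ : Fin m → domSpace w →ₗ[ℝ] ℝ) (D : ℝ) (hD : 0 ≤ D)
    (hψ : ∀ c : ℝ, 0 ≤ c → ∀ g : domSpace w, (∀ x, |(g : α → ℝ) x| ≤ c * w x) →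
      ∑ k, ψ k g ^ 2 ≤ (D * c) ^ 2) : GP w m ψ (m * D) := by
  intro t ht f hf
  have : ∀ k, ψ k (f k) ≤ D * t := by
    intro k
    have h1 : ∀ x, |(f k : α → ℝ) x| ≤ t * w x := by
      intro x
      refine abs_le_of_sq_le_sq ?_ (mul_nonneg ht (hw0 x))
      exact (Finset.single_le_sum (f := fun k => (f k : α → ℝ) x ^ 2) (fun i _ => sq_nonneg _)
        (Finset.mem_univ k)).trans (hf x)
    have h2 := hψ t ht (f k) h1
    have h3 := (Finset.single_le_sum (f := fun j => ψ j (f k) ^ 2) (fun i _ => sq_nonneg _)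
        (Finset.mem_univ k)).trans h2
    exact le_of_abs_le (abs_le_of_sq_le_sq h3 (by positivity))
  calc _ ≤ ∑ k : Fin m, D * t := Finset.sum_le_sum fun k _ => this k
    _ = _ := by simp; ring

theorem GP_step {α : Type*} [MeasurableSpace α] (w : α → ℝ) (hw : Measurable w) (hw0 : ∀ x, 0 ≤ w x)
    (m : ℕ) (ψ : Fin m → domSpace w →ₗ[ℝ] ℝ) (D : ℝ) (hD : 0 ≤ D)
    (hψ : ∀ c : ℝ, 0 ≤ c → ∀ g : domSpace w, (∀ x, |(g : α → ℝ) x| ≤ c * w x) →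
      ∑ k, ψ k g ^ 2 ≤ (D * c) ^ 2)
    (K : ℝ) (hK : GP w m ψ K) : GP w m ψ (2 * D * √m + K / 2) := by
  intro t ht f hf
  let F : (Fin m → Bool) → domSpace w := fun e => ∑ j, sg (e j) • f j
  have hF : ∀ e x, (F e : α → ℝ) x = ∑ j, sg (e j) * (f j : α → ℝ) x := by
    intro e x; simp [F]
  have hGb : ∀ e x, |max (-(2 * (t * w x))) (min (2 * (t * w x)) ((F e : α → ℝ) x))| ≤ (2 * t) * w x := by
    intro e x
    have := mul_nonneg ht (hw0 x)
    rw [abs_le]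
    constructor
    · rw [← mul_assoc]; exact le_max_left _ _
    · refine max_le (by linarith) ((min_le_left _ _).trans (by linarith))
  let G : (Fin m → Bool) → domSpace w := fun e =>
    ⟨fun x => max (-(2 * (t * w x))) (min (2 * (t * w x)) ((F e : α → ℝ) x)), by
      refine ⟨?_, 2 * t, hGb e⟩
      have := (F e).2.1
      fun_prop⟩
  let h : Fin m → domSpace w := fun k => (2 ^ m : ℝ)⁻¹ • ∑ e, sg (e k) • (F e - G e)
  have hh : ∀ x, ∑ k, (h k : α → ℝ) x ^ 2 ≤ ((t / 2) * w x) ^ 2 := by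
    intro x
    have := remainder_pt m (fun k => (f k : α → ℝ) x) (t * w x) (mul_nonneg ht (hw0 x)) (hf x)
    convert this using 1
    · refine Finset.sum_congr rfl fun k _ => ?_
      simp [h, G, hF]
    · ring
  have h1 := hK (t / 2) (by positivity) h hh
  have hfk : ∀ k, f k = (2 ^ m : ℝ)⁻¹ • ∑ e, sg (e k) • F e := by
    intro k
    ext x
    have := rad_bilin m (Pi.single k 1) (fun j => (f j : α → ℝ) x)
    simp [Pi.single_apply] at this
    simp [hF, this]
  have hsplit : ∀ k, ψ k (f k) = (2 ^ m : ℝ)⁻¹ * ∑ e, sg (e k) * ψ k (G e) + ψ k (h k) := by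
    intro k
    have : f k = (2 ^ m : ℝ)⁻¹ • ∑ e, sg (e k) • G e + h k := by
      rw [hfk k]
      simp only [h, ← smul_add, ← Finset.sum_add_distrib]
      simp
    conv_lhs => rw [this]
    simp
  have hGe : ∀ e, ∑ k, sg (e k) * ψ k (G e) ≤ 2 * D * √m * t := by
    intro e
    have h2 := hψ (2 * t) (by positivity) (G e) (hGb e)
    have h3 := Finset.sum_mul_sq_le_sq_mul_sq Finset.univ (fun k => sg (e k)) (fun k => ψ k (G e))
    have h4 : ∑ k, sg (e k) ^ 2 = m := by
      have : ∀ b, sg b ^ 2 = 1 := by intro b; cases b <;> simp [sg]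
      simp [this]
    rw [h4] at h3
    refine le_of_abs_le (abs_le_of_sq_le_sq ?_ (by positivity))
    refine h3.trans ?_
    calc _ ≤ (m : ℝ) * (D * (2 * t)) ^ 2 := by gcongr
      _ = (√m) ^ 2 * (D * (2 * t)) ^ 2 := by rw [Real.sq_sqrt (by positivity)]
      _ = _ := by ring
  calc ∑ k, ψ k (f k) = (2 ^ m : ℝ)⁻¹ * ∑ e, ∑ k, sg (e k) * ψ k (G e) + ∑ k, ψ k (h k) := by
        simp_rw [hsplit]
        rw [Finset.sum_add_distrib, ← Finset.mul_sum, Finset.sum_comm]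
    _ ≤ (2 ^ m : ℝ)⁻¹ * ∑ e : Fin m → Bool, 2 * D * √m * t + K * (t / 2) := by
        gcongr with e; exact hGe e
    _ = _ := by simp; ring

theorem groth {α : Type*} [MeasurableSpace α] (w : α → ℝ) (hw : Measurable w) (hw0 : ∀ x, 0 ≤ w x)
    (m : ℕ) (ψ : Fin m → domSpace w →ₗ[ℝ] ℝ) (D : ℝ) (hD : 0 ≤ D)
    (hψ : ∀ c : ℝ, 0 ≤ c → ∀ g : domSpace w, (∀ x, |(g : α → ℝ) x| ≤ c * w x) →
      ∑ k, ψ k g ^ 2 ≤ (D * c) ^ 2)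
    (f : Fin m → domSpace w) (hf : ∀ x, ∑ k, (f k : α → ℝ) x ^ 2 ≤ (w x) ^ 2) :
    ∑ k, ψ k (f k) ≤ 4 * D * √m := by
  have H : ∀ n : ℕ, GP w m ψ (4 * D * √m + m * D * (1 / 2) ^ n) := by
    intro n
    induction n with
    | zero =>
      intro t ht f hf
      refine (GP_base w hw0 m ψ D hD hψ t ht f hf).trans ?_
      gcongr
      have : 0 ≤ 4 * D * √m := by positivity
      simp; positivity
    | succ n ih =>
      have := GP_step w hw hw0 m ψ D hD hψ _ ih
      convert this using 1
      ring
  have hl : Filter.Tendsto (fun n : ℕ => 4 * D * √m + m * D * (1 / 2 : ℝ) ^ n) Filter.atTop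
      (nhds (4 * D * √m + m * D * 0)) :=
    ((_root_.tendsto_pow_atTop_nhds_zero_of_lt_one (by norm_num) (by norm_num)).const_mul _).const_add _
  rw [mul_zero, add_zero] at hl
  refine ge_of_tendsto' hl fun n => ?_
  simpa using H n 1 zero_le_one f (by simpa using hf)

theorem sumNorm_le_two (u : Lp ℝ 2 m0) :
    sumNormE 2 ∞ (u : ℝ →ₘ[m0] ℝ) ≤ eLpNorm (u : ℝ → ℝ) 2 m0 := by
  refine (iInf₂_le u (0 : Lp ℝ ∞ m0)).trans ?_
  refine (iInf_le _ (by simp)).trans ?_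
  rw [← Lp.enorm_def (0 : Lp ℝ ∞ m0)]
  simp

theorem sumNorm_le_infty (v : Lp ℝ ∞ m0) :
    sumNormE 2 ∞ (v : ℝ →ₘ[m0] ℝ) ≤ eLpNorm (v : ℝ → ℝ) ∞ m0 := by
  refine (iInf₂_le (0 : Lp ℝ 2 m0) v).trans ?_
  refine (iInf_le _ (by simp)).trans ?_
  rw [← Lp.enorm_def (0 : Lp ℝ 2 m0)]
  simp

def injL2 : Lp ℝ 2 m0 →ₗ[ℝ] sumSpace 2 ∞ where
  toFun u := ⟨(u : ℝ →ₘ[m0] ℝ), Submodule.mem_sup_left u.2⟩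
  map_add' _ _ := rfl
  map_smul' _ _ := rfl

def toL2 : interSpace 2 ∞ →ₗ[ℝ] Lp ℝ 2 m0 where
  toFun y := ⟨(y : ℝ →ₘ[m0] ℝ), y.2.1⟩
  map_add' _ _ := rfl
  map_smul' _ _ := rfl

def AA (m k : ℕ) : Set ℝ := Set.Ioc ((k : ℝ) / m) ((k + 1 : ℝ) / m)

theorem AA_meas (m k : ℕ) : MeasurableSet (AA m k) := measurableSet_Ioc

theorem AA_vol (m k : ℕ) : m0 (AA m k) = ENNReal.ofReal (1 / m) := by
  unfold m0
  rw [Measure.restrict_apply (AA_meas m k)]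
  have : AA m k ∩ Set.Ioi 0 = AA m k := by
    refine Set.inter_eq_left.2 fun x hx => ?_
    have : (0 : ℝ) ≤ (k : ℝ) / m := by positivity
    exact lt_of_le_of_lt this hx.1
  rw [this, AA, Real.volume_Ioc]
  congr 1
  ring

theorem AA_ne (m k : ℕ) : m0 (AA m k) ≠ ∞ := by rw [AA_vol]; exact ENNReal.ofReal_ne_top

theorem AA_real (m k : ℕ) : m0.real (AA m k) = 1 / m := by
  rw [Measure.real, AA_vol, ENNReal.toReal_ofReal (by positivity)]

theorem AA_disj (m : ℕ) (hm : 0 < m) {j k : ℕ} {x : ℝ} (hj : x ∈ AA m j) (hk : x ∈ AA m k) :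
    j = k := by
  have hm' : (0 : ℝ) < m := by exact_mod_cast hm
  obtain ⟨h1, h2⟩ := hj
  obtain ⟨h3, h4⟩ := hk
  have a1 : (j : ℝ) < k + 1 := by
    have := h1.trans_le h4
    rwa [div_lt_div_iff_of_pos_right hm'] at this
  have a2 : (k : ℝ) < j + 1 := by
    have := h3.trans_le h2
    rwa [div_lt_div_iff_of_pos_right hm'] at this
  have b1 : j < k + 1 := by exact_mod_cast a1
  have b2 : k < j + 1 := by exact_mod_cast a2
  omega

def xx (m k : ℕ) : Lp ℝ 2 m0 := √m • indicatorConstLp 2 (AA_meas m k) (AA_ne m k) (1 : ℝ)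

theorem xx_coe (m k : ℕ) : (xx m k : ℝ → ℝ) =ᵐ[m0] fun x => √m * (AA m k).indicator 1 x := by
  filter_upwards [Lp.coeFn_smul (√m) (indicatorConstLp 2 (AA_meas m k) (AA_ne m k) (1 : ℝ)),
    indicatorConstLp_coeFn (p := 2) (hs := AA_meas m k) (hμs := AA_ne m k) (c := (1 : ℝ))] with x h1 h2
  rw [xx, h1, Pi.smul_apply, h2]
  simp [Set.indicator]

theorem xx_orth (m : ℕ) (hm : 0 < m) : Orthonormal ℝ (xx m) := by
  have hm' : (0 : ℝ) < m := by exact_mod_cast hm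
  rw [orthonormal_iff_ite]
  intro j k
  rw [xx, xx, inner_smul_left, inner_smul_right,
    L2.real_inner_indicatorConstLp_one_indicatorConstLp_one (AA_meas m j) (AA_meas m k)
      (AA_ne m j) (AA_ne m k)]
  split_ifs with h
  · subst h
    rw [Set.inter_self, AA_real]
    simp only [conj_trivial]
    rw [← mul_assoc, Real.mul_self_sqrt hm'.le]
    field_simp
  · have : AA m j ∩ AA m k = ∅ := by
      ext x; simp only [Set.mem_inter_iff, Set.mem_empty_iff_false, iff_false]
      rintro ⟨h1, h2⟩; exact h (AA_disj m hm h1 h2)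
    simp [this]

theorem coe_sum_L2 {ι : Type*} (s : Finset ι) (a : ι → ℝ) (u : ι → Lp ℝ 2 m0) :
    ((∑ i ∈ s, a i • u i : Lp ℝ 2 m0) : ℝ → ℝ) =ᵐ[m0] fun x => ∑ i ∈ s, a i * (u i : ℝ → ℝ) x := by
  classical
  induction s using Finset.induction_on with
  | empty =>
    simp only [Finset.sum_empty]
    exact Lp.coeFn_zero _ _ _
  | insert i s hi ih =>
    rw [Finset.sum_insert hi]
    filter_upwards [ih, Lp.coeFn_add (a i • u i) (∑ i ∈ s, a i • u i), Lp.coeFn_smul (a i) (u i)]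
      with x h1 h2 h3
    rw [h2, Pi.add_apply, h3, h1, Finset.sum_insert hi]
    simp

theorem xx_sum_norm (m : ℕ) (hm : 0 < m) {ι : Type*} (s : Finset ι) (n : ι → ℕ)
    (hn : Function.Injective n) (a : ι → ℝ) :
    sumNormE 2 ∞ ((∑ i ∈ s, a i • xx m (n i) : Lp ℝ 2 m0) : ℝ →ₘ[m0] ℝ)
      ≤ ENNReal.ofReal (√(∑ i ∈ s, a i ^ 2)) := by
  refine (sumNorm_le_two _).trans ?_
  rw [← Lp.enorm_def, ← ofReal_norm]
  refine ENNReal.ofReal_le_ofReal (Real.le_sqrt_of_sq_le (le_of_eq ?_))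
  have := ((xx_orth m hm).comp n hn).inner_sum a a s
  rw [← real_inner_self_eq_norm_sq]
  simpa [sq] using this

theorem xx_sum_bdd (m : ℕ) (hm : 0 < m) (s : Finset ℕ) (a : ℕ → ℝ) (ha : ∀ k, |a k| ≤ 1) :
    sumNormE 2 ∞ ((∑ i ∈ s, a i • xx m i : Lp ℝ 2 m0) : ℝ →ₘ[m0] ℝ)
      ≤ ENNReal.ofReal (√m) := by
  have hb : ∀ᵐ x ∂m0, ‖((∑ i ∈ s, a i • xx m i : Lp ℝ 2 m0) : ℝ → ℝ) x‖ ≤ √m := by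
    filter_upwards [coe_sum_L2 s a (xx m), ae_all_iff.2 (xx_coe m)] with x h1 h2
    rw [h1]
    simp only [h2]
    by_cases h : ∃ k ∈ s, x ∈ AA m k
    · obtain ⟨k, hk, hx⟩ := h
      rw [Finset.sum_eq_single k]
      · rw [Set.indicator_of_mem hx]
        simp only [Pi.one_apply, mul_one, norm_mul, Real.norm_eq_abs, abs_of_nonneg (Real.sqrt_nonneg _)]
        have := ha k
        have := Real.sqrt_nonneg (m : ℝ)
        nlinarith
      · intro j _ hj
        rw [Set.indicator_of_notMem (fun hx' => hj (AA_disj m hm hx' hx))]; simp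
      · intro h; exact absurd hk h
    · rw [Finset.sum_eq_zero]
      · simp
      · intro j hj
        rw [Set.indicator_of_notMem (fun hx' => h ⟨j, hj, hx'⟩)]; simp
  have he : eLpNorm ((∑ i ∈ s, a i • xx m i : Lp ℝ 2 m0) : ℝ → ℝ) ∞ m0 ≤ ENNReal.ofReal (√m) := by
    rw [eLpNorm_exponent_top]
    exact eLpNormEssSup_le_of_ae_bound hb
  have hmem : ((∑ i ∈ s, a i • xx m i : Lp ℝ 2 m0) : ℝ →ₘ[m0] ℝ) ∈ Lp ℝ ∞ m0 :=
    Lp.mem_Lp_iff_eLpNorm_lt_top.2 (he.trans_lt ENNReal.ofReal_lt_top)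
  exact (sumNorm_le_infty ⟨_, hmem⟩).trans he

theorem sumSpace_intOn (m k : ℕ) (x : sumSpace 2 ∞) :
    IntegrableOn ((x : ℝ →ₘ[m0] ℝ) : ℝ → ℝ) (AA m k) m0 := by
  obtain ⟨u, hu, v, hv, h⟩ := Submodule.mem_sup.1 x.2
  have h1 := integrableOn_Lp_of_measure_ne_top (⟨u, hu⟩ : Lp ℝ 2 m0) (by norm_num) (AA_ne m k)
  have h2 := integrableOn_Lp_of_measure_ne_top (⟨v, hv⟩ : Lp ℝ ∞ m0) (by norm_num) (AA_ne m k)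
  rw [← h]
  exact (h1.add h2).congr (ae_restrict_of_ae (AEEqFun.coeFn_add u v).symm)

def phi (m k : ℕ) : sumSpace 2 ∞ →ₗ[ℝ] ℝ where
  toFun x := √m * ∫ t in AA m k, ((x : ℝ →ₘ[m0] ℝ) : ℝ → ℝ) t ∂m0
  map_add' x y := by
    rw [← mul_add, ← integral_add (sumSpace_intOn m k x) (sumSpace_intOn m k y)]
    congr 1
    exact integral_congr_ae (ae_restrict_of_ae (AEEqFun.coeFn_add _ _))
  map_smul' r x := by
    simp only [RingHom.id_apply, smul_eq_mul]
    rw [mul_left_comm r, ← integral_const_mul r]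
    congr 1
    exact integral_congr_ae (ae_restrict_of_ae (AEEqFun.coeFn_smul r (x : ℝ →ₘ[m0] ℝ)))

theorem phi_L2 (m k : ℕ) (u : Lp ℝ 2 m0) : phi m k (injL2 u) = inner ℝ (xx m k) u := by
  rw [xx, inner_smul_left, L2.inner_indicatorConstLp_one]
  rfl

theorem phi_bound (m : ℕ) (hm : 0 < m) (n : Fin m → ℕ) (hn : Function.Injective n)
    (x : sumSpace 2 ∞) :
    ENNReal.ofReal (√((∑ i, phi m (n i) x ^ 2) / 2)) ≤ sumNormE 2 ∞ (x : ℝ →ₘ[m0] ℝ) := by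
  have hm' : (0 : ℝ) < m := by exact_mod_cast hm
  refine le_iInf fun u => le_iInf fun v => le_iInf fun h => ?_
  rw [← Lp.enorm_def, ← Lp.enorm_def, ← ofReal_norm, ← ofReal_norm,
    ← ENNReal.ofReal_add (norm_nonneg _) (norm_nonneg _)]
  refine ENNReal.ofReal_le_ofReal (Real.sqrt_le_iff.2 ⟨by positivity, ?_⟩)
  let v' : sumSpace 2 ∞ := ⟨(v : ℝ →ₘ[m0] ℝ), Submodule.mem_sup_right v.2⟩
  have hx : x = injL2 u + v' := Subtype.ext h
  have h1 : ∑ i, phi m (n i) (injL2 u) ^ 2 ≤ ‖u‖ ^ 2 := by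
    have := ((xx_orth m hm).comp n hn).sum_inner_products_le u (s := Finset.univ)
    simpa [phi_L2] using this
  have h2 : ∀ k, phi m k v' ^ 2 ≤ ‖v‖ ^ 2 / m := by
    intro k
    have hb : ∀ᵐ t ∂(m0.restrict (AA m k)), ‖(v : ℝ → ℝ) t‖ ≤ ‖v‖ := by
      refine ae_restrict_of_ae ?_
      have := ae_le_eLpNormEssSup (f := (v : ℝ → ℝ)) (μ := m0)
      rw [← eLpNorm_exponent_top, ← Lp.enorm_def] at this
      filter_upwards [this] with t ht
      simpa using (enorm_le_iff_norm_le.1 ht)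
    have h3 := norm_setIntegral_le_of_norm_le_const_ae (AA_ne m k).lt_top hb
    rw [AA_real] at h3
    have h4 : phi m k v' = √m * ∫ t in AA m k, (v : ℝ → ℝ) t ∂m0 := rfl
    rw [h4, mul_pow, Real.sq_sqrt hm'.le, ← sq_abs, ← Real.norm_eq_abs]
    calc _ ≤ (m : ℝ) * (‖v‖ * (1 / m)) ^ 2 := by gcongr
      _ = _ := by field_simp
  have h3 : ∑ i, phi m (n i) v' ^ 2 ≤ ‖v‖ ^ 2 := by
    calc _ ≤ ∑ i : Fin m, ‖v‖ ^ 2 / m := Finset.sum_le_sum fun i _ => h2 _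
      _ = _ := by simp; field_simp
  have h4 : ∑ i, phi m (n i) x ^ 2 ≤ 2 * ∑ i, phi m (n i) (injL2 u) ^ 2
      + 2 * ∑ i, phi m (n i) v' ^ 2 := by
    rw [Finset.mul_sum, Finset.mul_sum, ← Finset.sum_add_distrib]
    refine Finset.sum_le_sum fun i _ => ?_
    rw [hx, map_add]
    nlinarith [sq_nonneg (phi m (n i) (injL2 u) - phi m (n i) v')]
  nlinarith [norm_nonneg u, norm_nonneg v, mul_nonneg (norm_nonneg u) (norm_nonneg v)]

theorem dom_norm (w : ℝ → ℝ) (g : ℝ → ℝ) (c : ℝ) (hc : 0 ≤ c) (hg : ∀ x, |g x| ≤ c * w x) (p : ℝ≥0∞) :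
    eLpNorm g p m0 ≤ ENNReal.ofReal c * eLpNorm w p m0 := by
  refine (eLpNorm_mono_real (g := c • w) (by simpa using hg)).trans ?_
  rw [eLpNorm_const_smul, Real.enorm_eq_ofReal hc]

theorem dom_mem (w : ℝ → ℝ) (p : ℝ≥0∞) (hp : eLpNorm w p m0 < ∞) (g : domSpace w) :
    eLpNorm (g : ℝ → ℝ) p m0 < ∞ := by
  obtain ⟨c, hc⟩ := g.2.2
  refine (eLpNorm_mono_real (g := c • w) (by simpa using hc)).trans_lt ?_
  rw [eLpNorm_const_smul]
  exact ENNReal.mul_lt_top (by simp) hp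

def Phi (w : ℝ → ℝ) (h2 : eLpNorm w 2 m0 < ∞) (hi : eLpNorm w ∞ m0 < ∞) :
    domSpace w →ₗ[ℝ] interSpace 2 ∞ where
  toFun g := ⟨AEEqFun.mk (g : ℝ → ℝ) g.2.1.aestronglyMeasurable, by
    have e : ∀ p, eLpNorm (AEEqFun.mk (g : ℝ → ℝ) g.2.1.aestronglyMeasurable : ℝ →ₘ[m0] ℝ) p m0
      = eLpNorm (g : ℝ → ℝ) p m0 := fun p => eLpNorm_congr_ae (AEEqFun.coeFn_mk _ _)
    constructor
    · exact Lp.mem_Lp_iff_eLpNorm_lt_top.2 ((e 2).trans_lt (dom_mem w 2 h2 g))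
    · exact Lp.mem_Lp_iff_eLpNorm_lt_top.2 ((e ∞).trans_lt (dom_mem w ∞ hi g))⟩
  map_add' _ _ := rfl
  map_smul' _ _ := rfl

theorem Phi_norm (w : ℝ → ℝ) (h2 : eLpNorm w 2 m0 < ∞) (hi : eLpNorm w ∞ m0 < ∞) (B : ℝ)
    (hB2 : eLpNorm w 2 m0 ≤ ENNReal.ofReal B) (hBi : eLpNorm w ∞ m0 ≤ ENNReal.ofReal B)
    (c : ℝ) (hc : 0 ≤ c) (g : domSpace w) (hg : ∀ x, |(g : ℝ → ℝ) x| ≤ c * w x) :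
    interNormE 2 ∞ (Phi w h2 hi g : ℝ →ₘ[m0] ℝ) ≤ ENNReal.ofReal (c * B) := by
  have e : ∀ p, eLpNorm (AEEqFun.mk (g : ℝ → ℝ) g.2.1.aestronglyMeasurable : ℝ →ₘ[m0] ℝ) p m0
      = eLpNorm (g : ℝ → ℝ) p m0 := fun p => eLpNorm_congr_ae (AEEqFun.coeFn_mk _ _)
  rw [ENNReal.ofReal_mul hc]
  refine max_le ?_ ?_
  · refine (e 2).trans_le ((dom_norm w g c hc hg 2).trans ?_)
    gcongr
  · refine (e ∞).trans_le ((dom_norm w g c hc hg ∞).trans ?_)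
    gcongr

theorem exists_signs {H : Type*} [NormedAddCommGroup H] [InnerProductSpace ℝ H] (Y : ℕ → H) (N : ℕ) :
    ∃ e : ℕ → ℝ, (∀ k, |e k| ≤ 1) ∧
      ∑ k ∈ Finset.range N, ‖Y k‖ ^ 2 ≤ ‖∑ k ∈ Finset.range N, e k • Y k‖ ^ 2 := by
  induction N with
  | zero => exact ⟨0, by simp, by simp⟩
  | succ N ih =>
    obtain ⟨e, he, h⟩ := ih
    have key : ∀ s : ℝ, ∑ k ∈ Finset.range (N+1), (Function.update e N s) k • Y k
        = ∑ k ∈ Finset.range N, e k • Y k + s • Y N := by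
      intro s
      rw [Finset.sum_range_succ, Function.update_self]
      congr 1
      refine Finset.sum_congr rfl fun k hk => ?_
      rw [Function.update_of_ne (Finset.mem_range.1 hk).ne]
    have hs : ∀ s : ℝ, |s| ≤ 1 → ∀ k, |Function.update e N s k| ≤ 1 := by
      intro s hs k
      by_cases hk : k = N
      · subst hk; simpa using hs
      · rw [Function.update_of_ne hk]; exact he k
    set Z := ∑ k ∈ Finset.range N, e k • Y k
    rcases le_total 0 (inner ℝ Z (Y N)) with h0 | h0
    · refine ⟨Function.update e N 1, hs 1 (by simp), ?_⟩
      rw [key, Finset.sum_range_succ, norm_add_sq_real, one_smul]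
      linarith
    · refine ⟨Function.update e N (-1), hs (-1) (by simp), ?_⟩
      rw [key, Finset.sum_range_succ, norm_add_sq_real, inner_smul_right, norm_smul]
      simp; linarith

/-- duality with rational vectors -/
theorem sq_le_of_rat (m : ℕ) (y : Fin m → ℝ) (c : ℝ) (hc : 0 ≤ c)
    (h : ∀ q : Fin m → ℚ, |∑ i, (q i : ℝ) * y i| ≤ c * √(∑ i, (q i : ℝ) ^ 2)) :
    ∑ i, y i ^ 2 ≤ c ^ 2 := by
  have hall : ∀ a : Fin m → ℝ, |∑ i, a i * y i| ≤ c * √(∑ i, a i ^ 2) := by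
    have hd : DenseRange (fun q : Fin m → ℚ => fun i => (q i : ℝ)) :=
      DenseRange.piMap (fun _ => Rat.denseRange_cast)
    intro a
    refine hd.induction_on (p := fun a : Fin m → ℝ => |∑ i, a i * y i| ≤ c * √(∑ i, a i ^ 2)) a ?_ h
    exact isClosed_le (by fun_prop) (by fun_prop)
  have := hall y
  have hs : 0 ≤ ∑ i, y i ^ 2 := Finset.sum_nonneg fun _ _ => sq_nonneg _
  have e : ∑ i, y i * y i = (√(∑ i, y i ^ 2)) ^ 2 := by
    rw [Real.sq_sqrt hs]; simp [sq]
  rw [e, abs_of_nonneg (sq_nonneg _)] at this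
  rw [← Real.sq_sqrt hs]
  have h0 := Real.sqrt_nonneg (∑ i, y i ^ 2)
  rcases h0.eq_or_lt with h0 | h0
  · rw [← h0, zero_pow two_ne_zero]; positivity
  · have : √(∑ i, y i ^ 2) ≤ c := by nlinarith
    gcongr

theorem main_bound (T : sumSpace 2 ∞ ≃ₗ[ℝ] interSpace 2 ∞) (c : ℝ) (hc : 1 ≤ c)
    (hT : ∀ f : sumSpace 2 ∞,
      interNormE 2 ∞ ((T f : ℝ →ₘ[m0] ℝ)) ≤ ENNReal.ofReal c * sumNormE 2 ∞ (f : ℝ →ₘ[m0] ℝ) ∧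
      sumNormE 2 ∞ (f : ℝ →ₘ[m0] ℝ) ≤ ENNReal.ofReal c * interNormE 2 ∞ ((T f : ℝ →ₘ[m0] ℝ)))
    (m : ℕ) (hm : 0 < m) : (m : ℝ) ≤ 4 * (2 * c ^ 2) * √m := by
  have hm' : (0 : ℝ) < m := by exact_mod_cast hm
  have hc0 : 0 ≤ c := by linarith
  let R : Lp ℝ 2 m0 →ₗ[ℝ] Lp ℝ 2 m0 := toL2 ∘ₗ T.toLinearMap ∘ₗ injL2
  have hR2 : ∀ (u : Lp ℝ 2 m0) (r : ℝ), 0 ≤ r → sumNormE 2 ∞ (u : ℝ →ₘ[m0] ℝ) ≤ ENNReal.ofReal r →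
      ‖R u‖ ≤ c * r := by
    intro u r hr h
    have h1 : eLpNorm (R u : ℝ → ℝ) 2 m0 ≤ ENNReal.ofReal (c * r) := by
      rw [ENNReal.ofReal_mul hc0]
      exact (le_max_left _ _).trans ((hT (injL2 u)).1.trans (by gcongr; exact h))
    rw [← Lp.enorm_def, ← ofReal_norm, ENNReal.ofReal_le_ofReal_iff (by positivity)] at h1
    exact h1
  have hRi : ∀ (u : Lp ℝ 2 m0) (r : ℝ), 0 ≤ r → sumNormE 2 ∞ (u : ℝ →ₘ[m0] ℝ) ≤ ENNReal.ofReal r →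
      ∀ᵐ t ∂m0, |(R u : ℝ → ℝ) t| ≤ c * r := by
    intro u r hr h
    have h1 : eLpNorm (R u : ℝ → ℝ) ∞ m0 ≤ ENNReal.ofReal (c * r) := by
      rw [ENNReal.ofReal_mul hc0]
      exact (le_max_right _ _).trans ((hT (injL2 u)).1.trans (by gcongr; exact h))
    rw [eLpNorm_exponent_top] at h1
    filter_upwards [ae_le_eLpNormEssSup (f := (R u : ℝ → ℝ)) (μ := m0)] with t ht
    have := ht.trans h1
    rw [← ofReal_norm, ENNReal.ofReal_le_ofReal_iff (by positivity)] at this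
    exact this
  let Y : ℕ → Lp ℝ 2 m0 := fun k => R (xx m k)
  -- the `L²` norms tend to zero
  have hsum : ∀ N, ∑ k ∈ Finset.range N, ‖Y k‖ ^ 2 ≤ (c * √m) ^ 2 := by
    intro N
    obtain ⟨e, he, h⟩ := exists_signs Y N
    refine h.trans ?_
    have h1 : ∑ k ∈ Finset.range N, e k • Y k = R (∑ k ∈ Finset.range N, e k • xx m k) := by
      simp [Y]
    rw [h1]
    gcongr
    exact hR2 _ _ (by positivity) (xx_sum_bdd m hm _ e he)
  have hsm : Summable fun k => ‖Y k‖ ^ 2 :=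
    summable_of_sum_range_le (fun _ => sq_nonneg _) hsum
  obtain ⟨n0, hn0⟩ : ∃ n0, ∀ k ≥ n0, ‖Y k‖ ^ 2 < 1 / m :=
    Filter.eventually_atTop.1 (hsm.tendsto_atTop_zero.eventually_lt_const (by positivity))
  let n : Fin m → ℕ := fun i => n0 + i
  have hn : Function.Injective n := fun i j h => Fin.ext (by simpa [n] using h)
  let y : Fin m → ℝ → ℝ := fun i => (Y (n i) : ℝ → ℝ)
  have hym : ∀ i, Measurable (y i) := fun i => (Lp.stronglyMeasurable _).measurable
  let w : ℝ → ℝ := fun t => √(∑ i, y i t ^ 2)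
  have hw0 : ∀ t, 0 ≤ w t := fun t => Real.sqrt_nonneg _
  have hwsq : ∀ t, w t ^ 2 = ∑ i, y i t ^ 2 := fun t =>
    Real.sq_sqrt (Finset.sum_nonneg fun _ _ => sq_nonneg _)
  have hwm : Measurable w := by
    have : Measurable fun t => ∑ i, y i t ^ 2 :=
      Finset.measurable_sum _ fun i _ => (hym i).pow_const 2
    exact this.sqrt
  have hwi : eLpNorm w ∞ m0 ≤ ENNReal.ofReal c := by
    rw [eLpNorm_exponent_top]
    refine eLpNormEssSup_le_of_ae_bound ?_
    have h1 : ∀ᵐ t ∂m0, ∀ q : Fin m → ℚ,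
        |∑ i, (q i : ℝ) * y i t| ≤ c * √(∑ i, (q i : ℝ) ^ 2) := by
      refine ae_all_iff.2 fun q => ?_
      have h2 := hRi _ _ (Real.sqrt_nonneg _)
        (xx_sum_norm m hm Finset.univ n hn (fun i => (q i : ℝ)))
      have h3 : R (∑ i, (q i : ℝ) • xx m (n i)) = ∑ i, (q i : ℝ) • Y (n i) := by
        rw [map_sum]; simp only [map_smul, Y]
      rw [h3] at h2
      filter_upwards [h2, coe_sum_L2 Finset.univ (fun i => (q i : ℝ)) (fun i => Y (n i))] with t a b
      rwa [b] at a
    filter_upwards [h1] with t ht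
    have := sq_le_of_rat m (fun i => y i t) c hc0 ht
    rw [← hwsq] at this
    exact abs_le_of_sq_le_sq this hc0
  have hw2 : eLpNorm w 2 m0 ≤ ENNReal.ofReal c := by
    have hY : ∀ i, ∫⁻ t, ‖y i t‖ₑ ^ 2 ∂m0 ≤ ENNReal.ofReal (1 / m) := by
      intro i
      have h1 : (∫⁻ t, ‖y i t‖ₑ ^ 2 ∂m0) = ‖Y (n i)‖ₑ ^ 2 := by
        rw [Lp.enorm_def, eLpNorm_eq_lintegral_rpow_enorm_toReal (by norm_num) (by norm_num)]
        simp only [ENNReal.toReal_ofNat, ENNReal.rpow_ofNat]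
        rw [← ENNReal.rpow_natCast, ← ENNReal.rpow_mul]
        simp [y]
      rw [h1, ← ofReal_norm, ← ENNReal.ofReal_pow (norm_nonneg _)]
      exact ENNReal.ofReal_le_ofReal (hn0 _ (by simp [n])).le
    have h1 : ∫⁻ t, ‖w t‖ₑ ^ 2 ∂m0 ≤ 1 := by
      calc ∫⁻ t, ‖w t‖ₑ ^ 2 ∂m0 = ∫⁻ t, ∑ i, ‖y i t‖ₑ ^ 2 ∂m0 := by
            refine lintegral_congr fun t => ?_
            have : ∀ r : ℝ, ‖r‖ₑ ^ 2 = ENNReal.ofReal (r ^ 2) := by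
              intro r
              rw [← ofReal_norm, ← ENNReal.ofReal_pow (norm_nonneg _)]; simp
            simp only [this]
            rw [hwsq, ENNReal.ofReal_sum_of_nonneg fun _ _ => sq_nonneg _]
        _ = ∑ i, ∫⁻ t, ‖y i t‖ₑ ^ 2 ∂m0 :=
            lintegral_finsetSum _ fun i _ => ((hym i).enorm.pow_const 2)
        _ ≤ ∑ i : Fin m, ENNReal.ofReal (1 / m) := Finset.sum_le_sum fun i _ => hY i
        _ = ENNReal.ofReal (∑ i : Fin m, 1 / (m : ℝ)) :=
            (ENNReal.ofReal_sum_of_nonneg fun _ _ => by positivity).symm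
        _ = 1 := by simp [hm'.ne']
    rw [eLpNorm_eq_lintegral_rpow_enorm_toReal (by norm_num) (by norm_num)]
    simp only [ENNReal.toReal_ofNat, ENNReal.rpow_ofNat]
    refine (ENNReal.rpow_le_one h1 (by norm_num)).trans ?_
    simpa using hc
  have h2t := hw2.trans_lt ENNReal.ofReal_lt_top
  have hit := hwi.trans_lt ENNReal.ofReal_lt_top
  let ψ : Fin m → domSpace w →ₗ[ℝ] ℝ := fun i =>
    phi m (n i) ∘ₗ T.symm.toLinearMap ∘ₗ Phi w h2t hit
  have hψ : ∀ d : ℝ, 0 ≤ d → ∀ g : domSpace w, (∀ x, |(g : ℝ → ℝ) x| ≤ d * w x) →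
      ∑ k, ψ k g ^ 2 ≤ ((2 * c ^ 2) * d) ^ 2 := by
    intro d hd g hg
    have h1 := Phi_norm w h2t hit c hw2 hwi d hd g hg
    have h2 := phi_bound m hm n hn (T.symm (Phi w h2t hit g))
    have h3 := (hT (T.symm (Phi w h2t hit g))).2
    rw [LinearEquiv.apply_symm_apply] at h3
    have h4 := (h2.trans h3).trans (mul_le_mul_right h1 _)
    rw [← ENNReal.ofReal_mul hc0, ENNReal.ofReal_le_ofReal_iff (by positivity),
      Real.sqrt_le_iff] at h4
    have h5 : (∑ i, ψ i g ^ 2) / 2 ≤ (c * (d * c)) ^ 2 := h4.2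
    nlinarith [sq_nonneg (c * (d * c))]
  have hymem : ∀ i, y i ∈ domSpace w := by
    intro i
    refine ⟨hym i, 1, fun t => ?_⟩
    rw [one_mul]
    refine abs_le_of_sq_le_sq ?_ (hw0 t)
    rw [hwsq]
    exact Finset.single_le_sum (f := fun i => y i t ^ 2) (fun _ _ => sq_nonneg _) (Finset.mem_univ i)
  have hfin := groth w hwm hw0 m ψ (2 * c ^ 2) (by positivity) hψ (fun i => ⟨y i, hymem i⟩)
    (fun t => (hwsq t).ge)
  have hone : ∀ i, ψ i ⟨y i, hymem i⟩ = 1 := by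
    intro i
    have h1 : Phi w h2t hit ⟨y i, hymem i⟩ = T (injL2 (xx m (n i))) := by
      refine Subtype.ext ?_
      exact AEEqFun.mk_coeFn _
    change phi m (n i) (T.symm (Phi w h2t hit ⟨y i, hymem i⟩)) = 1
    rw [h1, LinearEquiv.symm_apply_apply, phi_L2, real_inner_self_eq_norm_sq, (xx_orth m hm).1]
    norm_num
  simp only [hone] at hfin
  simpa using hfin

/-- The Banach spaces `L_2 + L_∞` and `L_2 ∩ L_∞` on `(0, ∞)` are not
isomorphic. -/
theorem L2_add_Linfty_not_isomorphic_L2_inter_Linfty : ¬ SumInterIsomorphic 2 ∞ := by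
  rintro ⟨T, C, -, hC, hT⟩
  set c : ℝ := max 1 C.toReal
  have hCc : C ≤ ENNReal.ofReal c := by
    rw [← ENNReal.ofReal_toReal hC.ne]
    exact ENNReal.ofReal_le_ofReal (le_max_right _ _)
  have hc : 1 ≤ c := le_max_left _ _
  have H := main_bound T c hc fun f =>
    ⟨(hT f).1.trans (by gcongr), (hT f).2.trans (by gcongr)⟩
  obtain ⟨m, hm⟩ := exists_nat_gt ((4 * (2 * c ^ 2)) ^ 2)
  have hm0 : (0 : ℝ) < m := lt_of_le_of_lt (by positivity) hm
  have h1 := H m (by exact_mod_cast hm0)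
  have h2 : 4 * (2 * c ^ 2) < √m := Real.lt_sqrt_of_sq_lt hm
  have h3 := Real.mul_self_sqrt hm0.le
  have h4 : 0 < √(m : ℝ) := Real.sqrt_pos.2 hm0
  nlinarith
end
end
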